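/- arXiv:math/0401249 — 5 statements merged into one kernel-verified Lean document; each statement's English description precedes it below -/
import Mathlib

section
/- For every pair of positive integers p and q there exists a function ψ : ℝ^p → ℝ^q with the following universal property. Let n, d be positive integers with d < n and p ≤ n − d ≤ q, and let f : ℝ^p × ℝ^q × ℝ^d → ℝ^{n−d} be measurable and such that for almost every fixed t ∈ ℝ^d: the map (y, ω) ↦ f(y, ω, t) is C¹; at every point (y, ω) the partial Jacobian ∂f/∂ω(y, ω, t) (an (n−d) × q matrix, i.e. a linear map ℝ^q → ℝ^{n−d}) is surjective (has full rank n − d); and the map (y, ω) ↦ ∂f/∂ω(y, ω, t) is Lipschitz. Then the set E_f := ⋃_{y ∈ ℝ^p} { (f(y, ψ(y), t), t) : t ∈ ℝ^d } ⊆ ℝ^{n−d} × ℝ^d has Lebesgue measure zero. -/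
open MeasureTheory

section

open Set Filter Topology
open scoped ENNReal

/-- An analytic set of positive outer measure contains a compact set of positive measure. -/
theorem MeasureTheory.AnalyticSet.exists_isCompact_subset_measure_pos {α : Type*}
    [TopologicalSpace α] [MeasurableSpace α] {μ : Measure α} [μ.OuterRegular] {s : Set α}
    (hs : AnalyticSet s) (h : μ s ≠ 0) : ∃ K ⊆ s, IsCompact K ∧ μ K ≠ 0 := by
  rw [AnalyticSet] at hs
  rcases hs with rfl | ⟨f, hf, rfl⟩
  · simp at h
  obtain ⟨a, ha0, ha⟩ := exists_between (pos_iff_ne_zero.2 h)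
  have step : ∀ (S : Set (ℕ → ℕ)) (k : ℕ), a < μ (f '' S) →
      ∃ n, a < μ (f '' (S ∩ {x | x k ≤ n})) := by
    intro S k hS
    have hU : f '' S = ⋃ n, f '' (S ∩ {x | x k ≤ n}) := by
      rw [← image_iUnion, ← inter_iUnion]
      congr 1
      rw [eq_comm, inter_eq_left]
      exact fun x _ => mem_iUnion.2 ⟨x k, le_refl (x k)⟩
    rw [hU, Monotone.measure_iUnion] at hS
    · exact lt_iSup_iff.1 hS
    · intro m n hmn
      exact image_mono (inter_subset_inter_right _ fun x (hx : x k ≤ m) => hx.trans hmn)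
  choose! n hn using step
  let S : ℕ → Set (ℕ → ℕ) := fun k =>
    Nat.rec univ (fun k S => S ∩ {x | x k ≤ n S k}) k
  have hS : ∀ k, a < μ (f '' S k) := by
    intro k
    induction k with
    | zero => simpa [S] using ha
    | succ k ih => exact hn _ _ ih
  let b : ℕ → ℕ := fun k => n (S k) k
  have hSb : ∀ k, ∀ x ∈ S k, ∀ i < k, x i ≤ b i := by
    intro k
    induction k with
    | zero => simp
    | succ k ih =>
      rintro x ⟨hx, hxk⟩ i hi
      rcases Nat.lt_succ_iff_lt_or_eq.1 hi with hi | rfl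
      · exact ih x hx i hi
      · exact hxk
  have hP : IsCompact (univ.pi fun i => Iic (b i)) :=
    isCompact_univ_pi fun i => (finite_Iic (b i)).isCompact
  refine ⟨f '' univ.pi fun i => Iic (b i), image_subset_range _ _, hP.image hf, fun h0 => ?_⟩
  obtain ⟨U, hKU, hU, hUa⟩ := Set.exists_isOpen_lt_of_lt _ a (h0 ▸ ha0)
  have hx : ∀ k, ∃ x ∈ S k, f x ∉ U := by
    intro k
    by_contra hc
    refine (((hS k).trans_le (measure_mono (image_subset_iff.2 fun x hx => ?_))).trans hUa).false
    by_contra hxU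
    exact hc ⟨x, hx, hxU⟩
  choose x hxS hxU using hx
  obtain ⟨z, hz, φ, hφ, hlim⟩ := hP.tendsto_subseq (x := fun k i => if i < k then x k i else 0)
    (fun k i _ => by
      by_cases hi : i < k
      · simpa [hi] using hSb k _ (hxS k) i hi
      · simp [hi])
  have hlim' : Tendsto (x ∘ φ) atTop (𝓝 z) := by
    rw [tendsto_pi_nhds] at hlim ⊢
    intro i
    refine (hlim i).congr' ?_
    filter_upwards [eventually_gt_atTop i] with k hk
    simp [hk.trans_le (hφ.id_le k)]
  have hzU : z ∈ f ⁻¹' U := hKU (mem_image_of_mem f hz)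
  obtain ⟨k, hk⟩ := (hlim'.eventually ((hU.preimage hf).mem_nhds hzU)).exists
  exact hxU _ hk

/-- An analytic subset of a product is null as soon as almost all its horizontal slices are. -/
theorem MeasureTheory.AnalyticSet.prod_null_of_ae_slice_null {α β : Type*}
    [TopologicalSpace α] [TopologicalSpace β] [T2Space α] [T2Space β]
    [SecondCountableTopology α] [SecondCountableTopology β]
    [MeasurableSpace α] [MeasurableSpace β] [BorelSpace α] [BorelSpace β]
    {μ : Measure α} {ν : Measure β} [SFinite μ] [SFinite ν] [(μ.prod ν).OuterRegular]
    {s : Set (α × β)} (hs : AnalyticSet s) (h : ∀ᵐ t ∂ν, μ ((fun x => (x, t)) ⁻¹' s) = 0) :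
    μ.prod ν s = 0 := by
  by_contra h0
  obtain ⟨K, hKs, hK, hK0⟩ := hs.exists_isCompact_subset_measure_pos h0
  refine hK0 ?_
  rw [Measure.prod_apply_symm hK.measurableSet, lintegral_eq_zero_iff
    (measurable_measure_prodMk_right hK.measurableSet)]
  filter_upwards [h] with t ht
  exact measure_mono_null (preimage_mono hKs) ht

/-- The index of the dyadic cube of side length `2⁻ᴺ` containing the point `y`. -/
noncomputable def dyadicIndex {ι : Type*} (N : ℕ) (y : ι → ℝ) : ι → ℤ :=
  fun i => ⌊2 ^ N * y i⌋

/-- The position of `y` relative to the corner of its dyadic cube of side length `2⁻ᴺ`. -/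
noncomputable def dyadicRem {ι : Type*} (N : ℕ) (y : ι → ℝ) : ι → ℝ :=
  fun i => y i - dyadicIndex N y i / 2 ^ N

theorem dyadicIndex_mono {ι : Type*} {M N : ℕ} (h : M ≤ N) {y z : ι → ℝ}
    (hyz : dyadicIndex N y = dyadicIndex N z) : dyadicIndex M y = dyadicIndex M z := by
  have key : ∀ x : ℝ, ⌊2 ^ M * x⌋ = ⌊2 ^ N * x⌋ / ((2 ^ (N - M) : ℕ) : ℤ) := by
    intro x
    rw [← Int.floor_div_natCast]
    congr 1
    obtain ⟨k, rfl⟩ := Nat.exists_eq_add_of_le h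
    simp only [Nat.add_sub_cancel_left, Nat.cast_pow, Nat.cast_ofNat]
    field_simp
    ring
  funext i
  simp only [dyadicIndex, key]
  rw [show ⌊2 ^ N * y i⌋ = ⌊2 ^ N * z i⌋ from congrFun hyz i]

theorem norm_dyadicRem_le {ι : Type*} [Fintype ι] (N : ℕ) (y : ι → ℝ) :
    ‖dyadicRem N y‖ ≤ (1 / 2) ^ N := by
  rw [pi_norm_le_iff_of_nonneg (by positivity)]
  intro i
  have h : dyadicRem N y i = Int.fract (2 ^ N * y i) * (1 / 2) ^ N := by
    simp only [dyadicRem, dyadicIndex, Int.fract, one_div, inv_pow]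
    field_simp
  rw [h, Real.norm_of_nonneg (mul_nonneg (Int.fract_nonneg _) (by positivity))]
  exact mul_le_of_le_one_left (by positivity) (Int.fract_lt_one _).le

theorem dyadicRem_sub_dyadicRem {ι : Type*} {N : ℕ} {y z : ι → ℝ}
    (h : dyadicIndex N y = dyadicIndex N z) : dyadicRem N y - dyadicRem N z = y - z := by
  funext i
  simp [dyadicRem, h]

theorem preimage_dyadicIndex_singleton {ι : Type*} (N : ℕ) (a : ι → ℤ) :
    dyadicIndex N ⁻¹' {a} =
      univ.pi fun i => Ico ((a i : ℝ) / 2 ^ N) (((a i : ℝ) + 1) / 2 ^ N) := by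
  ext y
  simp only [mem_preimage, mem_singleton_iff, funext_iff, dyadicIndex, Int.floor_eq_iff,
    mem_univ_pi, mem_Ico]
  refine forall_congr' fun i => ?_
  rw [div_le_iff₀ (by positivity), lt_div_iff₀ (by positivity), mul_comm (y i)]

theorem norm_sub_le_of_dyadicIndex_eq {ι : Type*} [Fintype ι] {N : ℕ} {y z : ι → ℝ}
    (h : dyadicIndex N y = dyadicIndex N z) : ‖y - z‖ ≤ (1 / 2) ^ N := by
  rw [pi_norm_le_iff_of_nonneg (by positivity)]
  intro i
  have h1 := Int.abs_sub_lt_one_of_floor_eq_floor (congrFun h i)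
  rw [← mul_sub, abs_mul, abs_of_pos (by positivity), mul_comm, ← lt_div_iff₀ (by positivity)] at h1
  simpa using h1.le

theorem volume_preimage_dyadicIndex_singleton {ι : Type*} [Fintype ι] (N : ℕ) (a : ι → ℤ) :
    volume (dyadicIndex N ⁻¹' {a}) = ENNReal.ofReal ((1 / 2) ^ N) ^ Fintype.card ι := by
  rw [preimage_dyadicIndex_singleton, Real.volume_pi_Ico,
    Finset.prod_eq_pow_card (b := ENNReal.ofReal ((1 / 2) ^ N))]
  · rfl
  intro i _
  congr 1
  rw [← sub_div]
  simp

theorem measurable_dyadicIndex {ι : Type*} (N : ℕ) :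
    Measurable (dyadicIndex N : (ι → ℝ) → ι → ℤ) :=
  measurable_pi_lambda _ fun i => Int.measurable_floor.comp ((measurable_pi_apply i).const_mul _)

theorem measurable_dyadicRem {ι : Type*} (N : ℕ) :
    Measurable (dyadicRem N : (ι → ℝ) → ι → ℝ) := by
  refine measurable_pi_lambda _ fun i => (measurable_pi_apply i).sub (Measurable.div_const ?_ _)
  exact (measurable_of_countable _).comp ((measurable_pi_apply i).comp (measurable_dyadicIndex N))

/-- A map has null range as soon as every point lies in arbitrarily strongly contracted dyadic
cubes. -/
theorem volume_range_eq_zero_of_dyadic {ι κ : Type*} [Fintype ι] [Fintype κ] [Nonempty κ]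
    (hcard : Fintype.card ι ≤ Fintype.card κ) (G : (ι → ℝ) → κ → ℝ)
    (hG : ∀ η : ℝ, 0 < η → ∀ y, ∃ N, ∀ z w, dyadicIndex N z = dyadicIndex N y →
      dyadicIndex N w = dyadicIndex N y → ‖G z - G w‖ ≤ η * (1 / 2) ^ N) :
    volume (range G) = 0 := by
  have hcov : range G = ⋃ a : ι → ℤ, G '' (dyadicIndex 0 ⁻¹' {a}) := by
    rw [← image_iUnion, ← preimage_iUnion, iUnion_of_singleton, preimage_univ, image_univ]
  rw [hcov, measure_iUnion_null_iff]
  intro a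
  set Q : Set (ι → ℝ) := dyadicIndex 0 ⁻¹' {a} with hQ
  have hQvol : volume Q = 1 := by rw [hQ, volume_preimage_dyadicIndex_singleton]; simp
  have key : ∀ η : ℝ, 0 < η → η ≤ 1 → volume (G '' Q) ≤ ENNReal.ofReal η := by
    intro η hη hη1
    classical
    have hG' := hG η hη
    let k : (ι → ℝ) → ℕ := fun y => Nat.find (hG' y)
    have hk : ∀ y z w, dyadicIndex (k y) z = dyadicIndex (k y) y →
        dyadicIndex (k y) w = dyadicIndex (k y) y → ‖G z - G w‖ ≤ η * (1 / 2) ^ k y :=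
      fun y => Nat.find_spec (hG' y)
    have hkmin : ∀ y z, dyadicIndex (k y) z = dyadicIndex (k y) y → k z ≤ k y := by
      intro y z hz
      refine Nat.find_min' (hG' z) fun u v hu hv => hk y u v ?_ ?_
      · exact hu.trans hz
      · exact hv.trans hz
    let C : ℕ × (ι → ℤ) → Set (ι → ℝ) := fun c => dyadicIndex c.1 ⁻¹' {c.2}
    let S : Set (ℕ × (ι → ℤ)) := (fun y => (k y, dyadicIndex (k y) y)) '' Q
    have hS : S.Countable := to_countable S
    have hQS : Q ⊆ ⋃ c ∈ S, C c := fun y hy =>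
      mem_biUnion (mem_image_of_mem _ hy) (rfl : dyadicIndex (k y) y = _)
    have hSQ : ⋃ c ∈ S, C c ⊆ Q := by
      refine iUnion₂_subset ?_
      rintro _ ⟨y, hy, rfl⟩ z hz
      exact (dyadicIndex_mono (Nat.zero_le _) hz).trans hy
    have hdisj : S.PairwiseDisjoint C := by
      rintro _ ⟨y, hy, rfl⟩ _ ⟨y', hy', rfl⟩ hne
      refine disjoint_left.2 fun z hz hz' => hne ?_
      have heq : ∀ y, dyadicIndex (k y) z = dyadicIndex (k y) y →
          (k y, dyadicIndex (k y) y) = (k z, dyadicIndex (k z) z) := by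
        intro y hz
        have h1 := hkmin y z hz
        have h2 := hkmin z y (dyadicIndex_mono h1 hz).symm
        rw [le_antisymm h1 h2, hz]
      exact (heq y hz).trans (heq y' hz').symm
    calc volume (G '' Q) ≤ volume (⋃ c ∈ S, G '' C c) := by
          rw [← image_iUnion₂]; exact measure_mono (image_mono hQS)
      _ ≤ ∑' c : S, volume (G '' C c) := measure_biUnion_le _ hS _
      _ ≤ ∑' c : S, ENNReal.ofReal η * volume (C c) := by
          refine ENNReal.tsum_le_tsum ?_
          rintro ⟨_, y, hy, rfl⟩
          refine (Real.volume_pi_le_diam_pow _).trans ?_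
          have hd : Metric.ediam (G '' C (k y, dyadicIndex (k y) y)) ≤
              ENNReal.ofReal (η * (1 / 2) ^ k y) := by
            refine Metric.ediam_le ?_
            rintro _ ⟨z, hz, rfl⟩ _ ⟨w, hw, rfl⟩
            rw [edist_dist, dist_eq_norm]
            exact ENNReal.ofReal_le_ofReal (hk y z w hz hw)
          refine (pow_le_pow_left' hd _).trans ?_
          simp only [C]
          rw [volume_preimage_dyadicIndex_singleton, ENNReal.ofReal_mul hη.le, mul_pow]
          gcongr ?_ * ?_
          · exact pow_le_of_le_one zero_le (ENNReal.ofReal_le_one.2 hη1) Fintype.card_ne_zero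
          · refine pow_le_pow_right_of_le_one' (ENNReal.ofReal_le_one.2 ?_) hcard
            exact pow_le_one₀ (by norm_num) (by norm_num)
      _ = ENNReal.ofReal η * volume (⋃ c ∈ S, C c) := by
          rw [ENNReal.tsum_mul_left, measure_biUnion hS hdisj]
          exact fun c _ => measurable_dyadicIndex _ (measurableSet_singleton _)
      _ ≤ ENNReal.ofReal η := by
          calc _ ≤ ENNReal.ofReal η * volume Q := by gcongr
            _ = _ := by rw [hQvol, mul_one]
  by_contra h0
  set m := min 1 (volume (G '' Q)) with hm
  have hm0 : m ≠ 0 := (lt_min one_pos (pos_iff_ne_zero.2 h0)).ne'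
  have hm1 : m ≤ 1 := min_le_left _ _
  have hmtop : m ≠ ∞ := ne_top_of_le_ne_top ENNReal.one_ne_top hm1
  have hlt : m / 2 < m := ENNReal.half_lt_self hm0 hmtop
  have := key (m / 2).toReal (ENNReal.toReal_pos (ENNReal.half_pos hm0).ne' hlt.ne_top)
    (ENNReal.toReal_le_of_le_ofReal zero_le_one (by simpa using hlt.le.trans hm1))
  rw [ENNReal.ofReal_toReal hlt.ne_top] at this
  exact ((this.trans_lt hlt).trans_le (min_le_right _ _)).false

theorem exists_strictMono_scales (b : ℕ → ℝ) : ∃ N : ℕ → ℕ, StrictMono N ∧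
    ∀ j, b j * (1 / 2) ^ N (j + 1) ≤ (1 / 2) ^ (j + 1) * (1 / 2) ^ N j := by
  have hs : ∀ j, ∃ s : ℕ, 1 ≤ s ∧ b j * (1 / 2) ^ s ≤ (1 / 2) ^ (j + 1) := by
    intro j
    have hlim : Tendsto (fun s : ℕ => b j * (1 / 2) ^ s) atTop (𝓝 (b j * 0)) :=
      (tendsto_pow_atTop_nhds_zero_of_lt_one (by norm_num) (by norm_num)).const_mul _
    rw [mul_zero] at hlim
    have hev := hlim.eventually_le_const (show (0 : ℝ) < (1 / 2) ^ (j + 1) by positivity)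
    exact ((eventually_ge_atTop 1).and hev).exists
  choose s hs1 hs using hs
  refine ⟨fun j => ∑ i ∈ Finset.range j, s i, strictMono_nat_of_lt_succ fun j => ?_, fun j => ?_⟩
  · rw [Finset.sum_range_succ]
    have := hs1 j
    omega
  · simp only [Finset.sum_range_succ]
    rw [add_comm, pow_add, ← mul_assoc]
    exact mul_le_mul_of_nonneg_right (hs j) (by positivity)

/-- For every sequence of slopes `A k` there is a function which, on all dyadic cubes of the
`k`-th scale, is affine with slope `A k` up to an error much smaller than the cube. -/
theorem exists_measurable_approx_affine {ι W : Type*} [Fintype ι] [NormedAddCommGroup W]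
    [NormedSpace ℝ W] [CompleteSpace W] [MeasurableSpace W] [BorelSpace W]
    [SecondCountableTopology W] (A : ℕ → (ι → ℝ) →L[ℝ] W) :
    ∃ (N : ℕ → ℕ) (ψ : (ι → ℝ) → W), StrictMono N ∧ Measurable ψ ∧
      ∀ k y z, dyadicIndex (N k) y = dyadicIndex (N k) z →
        ‖ψ y - ψ z - A k (y - z)‖ ≤ 2 * (1 / 2) ^ k * (1 / 2) ^ N k := by
  obtain ⟨N, hN, hAN⟩ := exists_strictMono_scales fun j => ‖A (j + 1) - A j‖
  let B : ℕ → (ι → ℝ) →L[ℝ] W := fun j => j.casesOn (A 0) fun j => A (j + 1) - A j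
  have hB : ∀ k, ∑ j ∈ Finset.range (k + 1), B j = A k := by
    intro k
    induction k with
    | zero => simp [B]
    | succ k ih => rw [Finset.sum_range_succ, ih]; simp [B]
  have hterm : ∀ y j, ‖B (j + 1) (dyadicRem (N (j + 1)) y)‖ ≤
      (1 / 2) ^ (j + 1) * (1 / 2) ^ N j := fun y j =>
    ((B (j + 1)).le_opNorm _).trans <|
      (mul_le_mul_of_nonneg_left (norm_dyadicRem_le _ _) (norm_nonneg _)).trans (hAN j)
  have hgeom : Summable fun j : ℕ => (1 / 2 : ℝ) ^ (j + 1) :=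
    (summable_nat_add_iff 1).2 summable_geometric_two
  have hsum : ∀ y, Summable fun j => B j (dyadicRem (N j) y) := by
    intro y
    rw [← summable_nat_add_iff 1]
    refine hgeom.of_norm_bounded fun j => (hterm y j).trans ?_
    exact mul_le_of_le_one_right (by positivity) (pow_le_one₀ (by norm_num) (by norm_num))
  refine ⟨N, fun y => ∑' j, B j (dyadicRem (N j) y), hN,
    Measurable.tsum fun j => (B j).continuous.measurable.comp (measurable_dyadicRem _), ?_⟩
  intro k y z hyz
  have hhead : ∑ j ∈ Finset.range (k + 1), (B j (dyadicRem (N j) y) - B j (dyadicRem (N j) z)) =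
      A k (y - z) := by
    rw [← hB k, _root_.sum_apply]
    refine Finset.sum_congr rfl fun j hj => ?_
    rw [← map_sub, dyadicRem_sub_dyadicRem (dyadicIndex_mono (hN.monotone ?_) hyz)]
    exact Nat.lt_succ_iff.1 (Finset.mem_range.1 hj)
  rw [← (hsum y).tsum_sub (hsum z), ← ((hsum y).sub (hsum z)).sum_add_tsum_nat_add (k + 1), hhead,
    add_sub_cancel_left]
  have hmaj : HasSum (fun i : ℕ => 2 * (1 / 2 : ℝ) ^ k * (1 / 2) ^ N k / 2 / 2 ^ i)
      (2 * (1 / 2) ^ k * (1 / 2) ^ N k) := hasSum_geometric_two' _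
  refine tsum_of_norm_bounded hmaj fun i => ?_
  have hpow : (1 / 2 : ℝ) ^ N (i + k) ≤ (1 / 2) ^ N k :=
    pow_le_pow_of_le_one (by norm_num) (by norm_num) (hN.monotone (Nat.le_add_left _ _))
  calc ‖B (i + (k + 1)) (dyadicRem (N (i + (k + 1))) y) -
        B (i + (k + 1)) (dyadicRem (N (i + (k + 1))) z)‖
      ≤ (1 / 2) ^ (i + k + 1) * (1 / 2) ^ N (i + k) +
        (1 / 2) ^ (i + k + 1) * (1 / 2) ^ N (i + k) :=
        norm_sub_le_of_le (hterm y (i + k)) (hterm z (i + k))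
    _ ≤ (1 / 2) ^ (i + k + 1) * (1 / 2) ^ N k + (1 / 2) ^ (i + k + 1) * (1 / 2) ^ N k := by
        gcongr
    _ = 2 * (1 / 2 : ℝ) ^ k * (1 / 2) ^ N k / 2 / 2 ^ i := by
        rw [pow_succ, pow_add, one_div_pow (2 : ℝ) i]
        ring

/-- In a separable space some sequence approximates every point by values attained infinitely
often. -/
theorem exists_seq_frequently_eq (X : Type*) [PseudoMetricSpace X]
    [TopologicalSpace.SeparableSpace X] [Nonempty X] :
    ∃ u : ℕ → X, ∀ x : X, ∀ ε : ℝ, 0 < ε → ∃ a, dist a x < ε ∧ ∃ᶠ k in atTop, u k = a := by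
  refine ⟨fun k => TopologicalSpace.denseSeq X k.unpair.1, fun x ε hε => ?_⟩
  obtain ⟨j, hj⟩ := (TopologicalSpace.denseRange_denseSeq X).exists_dist_lt x hε
  refine ⟨_, dist_comm x _ ▸ hj, frequently_atTop.2 fun n =>
    ⟨Nat.pair j n, Nat.right_le_pair _ _, ?_⟩⟩
  simp

/-- Let `ψ` be almost affine with slope `A k` on the dyadic cubes of the `k`-th scale, where every
slope is approximated infinitely often. If `F` is strictly differentiable at `(y, ψ y)` with
surjective second partial derivative, then `z ↦ F (z, ψ z)` contracts some dyadic cube around `y`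
by an arbitrarily small factor `η`. -/
theorem exists_dyadic_contracted {ι W V : Type*} [Fintype ι] [NormedAddCommGroup W]
    [NormedSpace ℝ W] [NormedAddCommGroup V] [NormedSpace ℝ V] [FiniteDimensional ℝ V]
    {A : ℕ → (ι → ℝ) →L[ℝ] W}
    (hA : ∀ T : (ι → ℝ) →L[ℝ] W, ∀ ε : ℝ, 0 < ε → ∃ S, dist S T < ε ∧ ∃ᶠ k in atTop, A k = S)
    {N : ℕ → ℕ} (hN : StrictMono N) {ψ : (ι → ℝ) → W}
    (hψ : ∀ k y z, dyadicIndex (N k) y = dyadicIndex (N k) z →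
      ‖ψ y - ψ z - A k (y - z)‖ ≤ 2 * (1 / 2) ^ k * (1 / 2) ^ N k)
    {F : (ι → ℝ) × W → V} {y : ι → ℝ} {L : (ι → ℝ) × W →L[ℝ] V}
    (hF : HasStrictFDerivAt F L (y, ψ y))
    (hL : Function.Surjective (L.comp (ContinuousLinearMap.inr ℝ (ι → ℝ) W)))
    {η : ℝ} (hη : 0 < η) :
    ∃ M, ∀ z w, dyadicIndex M z = dyadicIndex M y → dyadicIndex M w = dyadicIndex M y →
      ‖F (z, ψ z) - F (w, ψ w)‖ ≤ η * (1 / 2) ^ M := by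
  obtain ⟨R, hR⟩ := LinearMap.exists_rightInverse_of_surjective
    (L.comp (ContinuousLinearMap.inr ℝ (ι → ℝ) W)).toLinearMap (LinearMap.range_eq_top.2 hL)
  have hR' : ∀ v, L (0, R v) = v := fun v => LinearMap.congr_fun hR v
  let T : (ι → ℝ) →L[ℝ] W :=
    -(R.toContinuousLinearMap.comp (L.comp (ContinuousLinearMap.inl ℝ (ι → ℝ) W)))
  have hT : ∀ u, L (u, T u) = 0 := by
    intro u
    have h1 : ((u, T u) : (ι → ℝ) × W) = (u, 0) - (0, R (L (u, 0))) := by simp [T]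
    rw [h1, map_sub, hR', sub_self]
  obtain ⟨S, hST, hfreq⟩ := hA T (η / (3 * (‖L‖ + 1))) (by positivity)
  have hLS : ‖L‖ * ‖S - T‖ ≤ η / 3 := by
    rw [dist_eq_norm, lt_div_iff₀ (by positivity)] at hST
    nlinarith [norm_nonneg L, norm_nonneg (S - T)]
  set c : ℝ := η / (3 * (‖S‖ + 3)) with hc
  have hc0 : 0 < c := by positivity
  have hcS : c * (‖S‖ + 3) = η / 3 := by rw [hc]; field_simp
  obtain ⟨U, hU, hFU⟩ := hF.approximates_deriv_on_nhds (c := ⟨c, hc0.le⟩) (Or.inr hc0)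
  obtain ⟨r, hr, hrU⟩ := Metric.mem_nhds_iff.1 hU
  have hlim : Tendsto (fun k : ℕ => (1 / 2 : ℝ) ^ k) atTop (𝓝 0) :=
    tendsto_pow_atTop_nhds_zero_of_lt_one (by norm_num) (by norm_num)
  have hsmall : ∀ᶠ k in atTop, ‖L‖ * (2 * (1 / 2 : ℝ) ^ k) ≤ η / 3 := by
    have := (hlim.const_mul 2).const_mul ‖L‖
    simp only [mul_zero] at this
    exact this.eventually_le_const (by positivity)
  have hnear : ∀ᶠ k in atTop, (‖S‖ + 3) * (1 / 2 : ℝ) ^ N k < r := by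
    have := (hlim.comp hN.tendsto_atTop).const_mul (‖S‖ + 3)
    rw [mul_zero] at this
    exact this.eventually_lt_const hr
  obtain ⟨k, hkS, hk1, hk2⟩ := (hfreq.and_eventually (hsmall.and hnear)).exists
  set δ : ℝ := (1 / 2) ^ N k with hδ
  have hδ0 : 0 < δ := by positivity
  have hψk : ∀ z w, dyadicIndex (N k) z = dyadicIndex (N k) w →
      ‖ψ z - ψ w - S (z - w)‖ ≤ 2 * (1 / 2) ^ k * δ := by
    rw [← hkS]; exact hψ k
  have hle1 : (1 / 2 : ℝ) ^ k ≤ 1 := pow_le_one₀ (by norm_num) (by norm_num)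
  have hgraph : ∀ z w, dyadicIndex (N k) z = dyadicIndex (N k) w →
      ‖((z, ψ z) : (ι → ℝ) × W) - (w, ψ w)‖ ≤ (‖S‖ + 3) * δ := by
    intro z w hzw
    have h1 := norm_sub_le_of_dyadicIndex_eq hzw
    rw [← hδ] at h1
    have h2 : ‖S (z - w)‖ ≤ ‖S‖ * δ := S.le_opNorm_of_le h1
    have h3 : ‖ψ z - ψ w‖ ≤ ‖ψ z - ψ w - S (z - w)‖ + ‖S (z - w)‖ := norm_le_norm_sub_add _ _
    have h4 := hψk z w hzw
    rw [Prod.mk_sub_mk, Prod.norm_mk, max_le_iff]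
    constructor <;> nlinarith [norm_nonneg S]
  refine ⟨N k, fun z w hz hw => ?_⟩
  have hzw := hz.trans hw.symm
  have hmem : ∀ z, dyadicIndex (N k) z = dyadicIndex (N k) y → (z, ψ z) ∈ U := fun z hz =>
    hrU (by rw [Metric.mem_ball, dist_eq_norm]; exact (hgraph z y hz).trans_lt hk2)
  have happ : ‖F (z, ψ z) - F (w, ψ w) - L ((z, ψ z) - (w, ψ w))‖ ≤
      c * ‖((z, ψ z) : (ι → ℝ) × W) - (w, ψ w)‖ := hFU _ (hmem z hz) _ (hmem w hw)
  have happ' : c * ‖((z, ψ z) : (ι → ℝ) × W) - (w, ψ w)‖ ≤ η / 3 * δ := by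
    rw [← hcS, mul_assoc]
    exact mul_le_mul_of_nonneg_left (hgraph z w hzw) hc0.le
  have hsplit : L ((z, ψ z) - (w, ψ w)) =
      L (0, (S - T) (z - w)) + L (0, ψ z - ψ w - S (z - w)) := by
    have h1 : ((z, ψ z) : (ι → ℝ) × W) - (w, ψ w) =
        (z - w, T (z - w)) + ((0, (S - T) (z - w)) + (0, ψ z - ψ w - S (z - w))) := by
      ext1
      · simp
      · simp only [Prod.mk_sub_mk, Prod.mk_add_mk, _root_.sub_apply]
        abel
    rw [h1, map_add, hT, zero_add, map_add]
  have hL0 : ∀ x : W, ‖L (0, x)‖ ≤ ‖L‖ * ‖x‖ := fun x => by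
    simpa using L.le_opNorm ((0, x) : (ι → ℝ) × W)
  have h1 : ‖L (0, (S - T) (z - w))‖ ≤ η / 3 * δ := by
    refine (hL0 _).trans ?_
    calc ‖L‖ * ‖(S - T) (z - w)‖ ≤ ‖L‖ * (‖S - T‖ * δ) := by
          gcongr
          exact (S - T).le_opNorm_of_le (norm_sub_le_of_dyadicIndex_eq hzw)
      _ ≤ η / 3 * δ := by rw [← mul_assoc]; gcongr
  have h2 : ‖L (0, ψ z - ψ w - S (z - w))‖ ≤ η / 3 * δ := by
    refine (hL0 _).trans ?_
    calc ‖L‖ * ‖ψ z - ψ w - S (z - w)‖ ≤ ‖L‖ * (2 * (1 / 2) ^ k * δ) := by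
          gcongr
          exact hψk z w hzw
      _ ≤ η / 3 * δ := by rw [← mul_assoc]; gcongr
  calc ‖F (z, ψ z) - F (w, ψ w)‖
      ≤ ‖F (z, ψ z) - F (w, ψ w) - L ((z, ψ z) - (w, ψ w))‖ + ‖L ((z, ψ z) - (w, ψ w))‖ :=
        norm_le_norm_sub_add _ _
    _ ≤ η / 3 * δ + (η / 3 * δ + η / 3 * δ) := by
        rw [hsplit] at happ ⊢
        exact add_le_add (happ.trans happ') (norm_add_le_of_le h1 h2)
    _ = η * δ := by ring

end


/-- Main theorem: for every `p, q` there is a universal `ψ : ℝ^p → ℝ^q` such that for all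
`n, d` with `d < n` and `p ≤ n - d ≤ q`, and every measurable
`f : ℝ^p × ℝ^q × ℝ^d → ℝ^{n-d}` such that for a.e. `t` the map `(y, ω) ↦ f y ω t` is `C¹`
with everywhere surjective and Lipschitz partial Jacobian `∂f/∂ω`, the set
`E_f = ⋃_y { (f y (ψ y) t, t) : t }` is a Lebesgue null subset of `ℝ^{n-d} × ℝ^d`. -/
theorem universal_null_packing (p q : ℕ) (hp : 0 < p) (hq : 0 < q) :
    ∃ ψ : (Fin p → ℝ) → (Fin q → ℝ),
      ∀ n d : ℕ, 0 < n → 0 < d → d < n → p ≤ n - d → n - d ≤ q →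
        ∀ f : (Fin p → ℝ) → (Fin q → ℝ) → (Fin d → ℝ) → (Fin (n - d) → ℝ),
          Measurable (fun x : ((Fin p → ℝ) × (Fin q → ℝ)) × (Fin d → ℝ) =>
            f x.1.1 x.1.2 x.2) →
          (∀ᵐ t : Fin d → ℝ,
            ContDiff ℝ 1 (fun yω : (Fin p → ℝ) × (Fin q → ℝ) => f yω.1 yω.2 t) ∧
            (∀ (y : Fin p → ℝ) (ω : Fin q → ℝ),
              Function.Surjective (fderiv ℝ (fun ω' : Fin q → ℝ => f y ω' t) ω)) ∧
            (∃ K : NNReal, LipschitzWith K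
              (fun yω : (Fin p → ℝ) × (Fin q → ℝ) =>
                fderiv ℝ (fun ω' : Fin q → ℝ => f yω.1 ω' t) yω.2))) →
          volume {xt : (Fin (n - d) → ℝ) × (Fin d → ℝ) |
            ∃ (y : Fin p → ℝ) (t : Fin d → ℝ), xt = (f y (ψ y) t, t)} = 0 := by
  obtain ⟨A, hA⟩ := exists_seq_frequently_eq ((Fin p → ℝ) →L[ℝ] (Fin q → ℝ))
  obtain ⟨N, ψ, hN, hψm, hψ⟩ := exists_measurable_approx_affine A
  refine ⟨ψ, fun n d _ _ hdn hpn _ f hf hreg => ?_⟩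
  have : Nonempty (Fin (n - d)) := ⟨⟨0, Nat.sub_pos_of_lt hdn⟩⟩
  have hmeas : Measurable fun x : (Fin p → ℝ) × (Fin d → ℝ) => (f x.1 (ψ x.1) x.2, x.2) :=
    (hf.comp ((measurable_fst.prodMk (hψm.comp measurable_fst)).prodMk measurable_snd)).prodMk
      measurable_snd
  have hset : {xt : (Fin (n - d) → ℝ) × (Fin d → ℝ) |
      ∃ (y : Fin p → ℝ) (t : Fin d → ℝ), xt = (f y (ψ y) t, t)} =
      (fun x : (Fin p → ℝ) × (Fin d → ℝ) => (f x.1 (ψ x.1) x.2, x.2)) '' Set.univ := by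
    ext xt
    simp [eq_comm]
  have han := MeasurableSet.univ.analyticSet_image hmeas
  rw [hset]
  refine han.prod_null_of_ae_slice_null ?_
  filter_upwards [hreg] with t ⟨hC, hsurj, _⟩
  refine measure_mono_null ?_ (volume_range_eq_zero_of_dyadic (by simpa using hpn)
    (fun y => f y (ψ y) t) fun η hη y => ?_)
  · rintro x ⟨⟨y, s⟩, -, hx⟩
    obtain ⟨rfl, rfl⟩ := Prod.mk.inj hx
    exact ⟨y, rfl⟩
  · have hF := hC.contDiffAt.hasStrictFDerivAt (x := (y, ψ y)) one_ne_zero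
    refine exists_dyadic_contracted hA hN hψ hF ?_ hη
    have hpart : HasFDerivAt (fun ω : Fin q → ℝ => f y ω t) _ (ψ y) :=
      hF.hasFDerivAt.comp (ψ y) (hasFDerivAt_prodMk_right y (ψ y))
    rw [← hpart.fderiv]
    exact hsurj y (ψ y)
end

section
/- There is a function ψ : ℝ → ℝ with the following property: for every positive integer n and every Borel measurable function g : ℝ × ℝ^{n−1} → ℝ such that for almost every t ∈ ℝ^{n−1} the map y ↦ g(y, t) is C¹, the set E := ⋃_{y ∈ ℝ} { (x, t) ∈ ℝ × ℝ^{n−1} : x = g(y, t) − ψ(y) } has n-dimensional Lebesgue measure zero. -/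
open MeasureTheory

namespace Sawyer

/-- A sequence of rational slopes taking every rational value infinitely often. -/
noncomputable def slope (k : ℕ) : ℝ :=
  ((Encodable.decode (α := ℚ) k.unpair.1).getD 0 : ℚ)

/-- The increments of `slope`. -/
noncomputable def slopeStep : ℕ → ℝ
  | 0 => slope 0
  | k + 1 => slope (k + 1) - slope k

/-- The number of grid cells per unit length at level `k`. -/
noncomputable def freq (k : ℕ) : ℕ :=
  ∏ i ∈ Finset.range k, 2 ^ (i + 1) * (⌈|slopeStep (i + 1)|⌉₊ + 1)

/-- The universal translation: its partial sum up to level `k` is affine with slope `slope k` on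
every cell of level `k`. -/
noncomputable def shift (y : ℝ) : ℝ :=
  ∑' k, slopeStep k * (Int.fract (y * freq k) / freq k)

/-- The left endpoint of the `j`-th cell of level `k`. -/
noncomputable def node (k : ℕ) (j : ℤ) : ℝ := j / freq k

lemma exists_slope_eq (q : ℚ) (N : ℕ) : ∃ k ≥ N, slope k = q :=
  ⟨Nat.pair (Encodable.encode q) N, Nat.right_le_pair _ _, by simp [slope]⟩

lemma sum_slopeStep (k : ℕ) : ∑ i ∈ Finset.range (k + 1), slopeStep i = slope k := by
  induction k with
  | zero => simp [slopeStep]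
  | succ k ih => rw [Finset.sum_range_succ, ih]; simp [slopeStep]

lemma freq_succ (k : ℕ) :
    freq (k + 1) = freq k * (2 ^ (k + 1) * (⌈|slopeStep (k + 1)|⌉₊ + 1)) :=
  Finset.prod_range_succ _ _

lemma two_pow_le_freq (k : ℕ) : 2 ^ k ≤ freq k := by
  induction k with
  | zero => simp [freq]
  | succ k ih =>
    rw [freq_succ, pow_succ]
    refine Nat.mul_le_mul ih ?_
    exact Nat.mul_le_mul (Nat.pow_le_pow_right (n := 2) two_pos (Nat.le_add_left 1 k))
      (Nat.le_add_left 1 _)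

lemma freq_pos (k : ℕ) : (0 : ℝ) < freq k := by
  exact_mod_cast (pow_pos two_pos k).trans_le (two_pow_le_freq k)

lemma one_le_freq (k : ℕ) : (1 : ℝ) ≤ freq k := by
  exact_mod_cast Nat.one_le_two_pow.trans (two_pow_le_freq k)

lemma freq_dvd {i k : ℕ} (h : i ≤ k) : freq i ∣ freq k :=
  Finset.prod_dvd_prod_of_subset _ _ _ (Finset.range_subset_range.2 h)

lemma abs_slopeStep_div_freq_le (k i : ℕ) :
    |slopeStep (i + (k + 1))| / freq (i + (k + 1)) ≤
      1 / (freq k * 2 ^ k) / 2 / 2 ^ i := by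
  have h1 : (freq k : ℝ) ≤ freq (i + k) := by
    exact_mod_cast Nat.le_of_dvd (by exact_mod_cast freq_pos (i + k)) (freq_dvd (by omega))
  have hk := freq_pos k
  have h2 := Nat.le_ceil |slopeStep (i + (k + 1))|
  rw [show i + (k + 1) = (i + k) + 1 by ring] at *
  have h3 : (freq (i + k + 1) : ℝ) =
      freq (i + k) * (2 ^ (i + k + 1) * (⌈|slopeStep (i + k + 1)|⌉₊ + 1)) := by
    exact_mod_cast freq_succ (i + k)
  rw [h3]
  set m : ℝ := (⌈|slopeStep (i + k + 1)|⌉₊ : ℝ)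
  have hm : 0 ≤ m := Nat.cast_nonneg _
  calc |slopeStep (i + k + 1)| / (freq (i + k) * (2 ^ (i + k + 1) * (m + 1)))
      ≤ (m + 1) / (freq k * (2 ^ (i + k + 1) * (m + 1))) := by gcongr; linarith
    _ = _ := by
      field_simp
      ring

lemma abs_fract_sub_le (x y : ℝ) : |Int.fract x - Int.fract y| ≤ 1 := by
  have := Int.fract_nonneg x
  have := Int.fract_nonneg y
  have := Int.fract_lt_one x
  have := Int.fract_lt_one y
  rw [abs_le]
  constructor <;> linarith

lemma summable_shift (y : ℝ) :
    Summable fun k => slopeStep k * (Int.fract (y * freq k) / freq k) := by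
  rw [← summable_nat_add_iff 1]
  refine Summable.of_norm_bounded (summable_geometric_two' (1 / (freq 0 * 2 ^ 0))) fun i => ?_
  refine le_trans ?_ (abs_slopeStep_div_freq_le 0 i)
  rw [Real.norm_eq_abs, abs_mul, abs_div, Nat.abs_cast, ← mul_div_assoc, Int.abs_fract]
  gcongr
  exact mul_le_of_le_one_right (abs_nonneg _) (Int.fract_lt_one _).le

lemma floor_mul_freq_eq {i k : ℕ} (h : i ≤ k) {y z : ℝ} (hyz : ⌊y * freq k⌋ = ⌊z * freq k⌋) :
    ⌊y * freq i⌋ = ⌊z * freq i⌋ := by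
  obtain ⟨m, hm⟩ := freq_dvd h
  have hm0 : (m : ℝ) ≠ 0 := by
    intro h0
    have := freq_pos k
    rw [hm] at this
    simp [h0] at this
  have key (x : ℝ) : ⌊x * freq i⌋ = ⌊x * freq k⌋ / (m : ℤ) := by
    rw [← Int.floor_div_natCast, hm]
    push_cast
    congr 1
    field_simp
  rw [key, key, hyz]

lemma abs_shift_sub_le (k : ℕ) {y z : ℝ} (hyz : ⌊y * freq k⌋ = ⌊z * freq k⌋) :
    |shift y - shift z - slope k * (y - z)| ≤ 1 / (freq k * 2 ^ k) := by
  rw [shift, shift, ← (summable_shift y).tsum_sub (summable_shift z),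
    ← ((summable_shift y).sub (summable_shift z)).sum_add_tsum_nat_add (k + 1)]
  have hhead : ∑ i ∈ Finset.range (k + 1), (slopeStep i * (Int.fract (y * freq i) / freq i) -
      slopeStep i * (Int.fract (z * freq i) / freq i)) = slope k * (y - z) := by
    rw [← sum_slopeStep, Finset.sum_mul]
    refine Finset.sum_congr rfl fun i hi => ?_
    have hi' := freq_pos i
    rw [Int.fract, Int.fract,
      floor_mul_freq_eq (Nat.lt_succ_iff.1 (Finset.mem_range.1 hi)) hyz]
    field_simp
    ring
  rw [hhead, add_sub_cancel_left, ← Real.norm_eq_abs]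
  refine tsum_of_norm_bounded (hasSum_geometric_two' (1 / (freq k * 2 ^ k : ℝ))) fun i => ?_
  refine le_trans ?_ (abs_slopeStep_div_freq_le k i)
  rw [← mul_sub, ← sub_div, Real.norm_eq_abs, abs_mul, abs_div, Nat.abs_cast, ← mul_div_assoc]
  gcongr
  exact mul_le_of_le_one_right (abs_nonneg _) (abs_fract_sub_le _ _)

lemma floor_mul_freq_eq_iff {k : ℕ} {j : ℤ} {y : ℝ} :
    ⌊y * freq k⌋ = j ↔ y ∈ Set.Ico (node k j) (node k (j + 1)) := by
  rw [Int.floor_eq_iff, Set.mem_Ico, node, node, div_le_iff₀ (freq_pos k),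
    lt_div_iff₀ (freq_pos k)]
  push_cast
  rfl

lemma node_succ (k : ℕ) (j : ℤ) : node k (j + 1) = node k j + 1 / freq k := by
  simp [node, add_div]

lemma floor_node_mul_freq (k : ℕ) (j : ℤ) : ⌊node k j * freq k⌋ = j := by
  rw [node, div_mul_cancel₀ _ (freq_pos k).ne', Int.floor_intCast]

/-- On the `j`-th cell of level `k`, the function `f` deviates by at most `ε` times the length of
the cell from an affine function of slope `slope k`; only rational points are tested. -/
def IsGood (ε : ℝ) (f : ℝ → ℝ) (k : ℕ) (j : ℤ) : Prop :=
  1 / 2 ^ k ≤ ε ∧ ∀ q : ℚ, (q : ℝ) ∈ Set.Ioo (node k j) (node k (j + 1)) →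
    |f q - f (node k j) - slope k * (q - node k j)| ≤ ε / freq k

/-- The maximal good cells with left endpoint in `[a, a + 1)`. -/
def maximalCells (ε : ℝ) (f : ℝ → ℝ) (a : ℤ) : Set (ℕ × ℤ) :=
  {p | node p.1 p.2 ∈ Set.Ico (a : ℝ) (a + 1) ∧ IsGood ε f p.1 p.2 ∧
    ∀ i < p.1, ¬ IsGood ε f i ⌊node p.1 p.2 * freq i⌋}

/-- Intervals which contain the image of `[a, a + 1)` under `f - shift`. -/
noncomputable def imageCover (ε : ℝ) (f : ℝ → ℝ) (a : ℤ) : Set ℝ :=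
  ⋃ p ∈ maximalCells ε f a,
    Metric.closedBall (f (node p.1 p.2) - shift (node p.1 p.2)) (2 * ε / freq p.1)

lemma exists_isGood {f : ℝ → ℝ} {y ε : ℝ} (hf : DifferentiableAt ℝ f y) (hε : 0 < ε) :
    ∃ k, IsGood ε f k ⌊y * freq k⌋ := by
  obtain ⟨q, hq1, hq2⟩ := exists_rat_btwn (show deriv f y < deriv f y + ε / 4 by linarith)
  have ho := (hasDerivAt_iff_isLittleO.1 hf.hasDerivAt).def (by positivity : 0 < ε / 4)
  obtain ⟨δ, hδ, hball⟩ := Metric.eventually_nhds_iff.1 ho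
  obtain ⟨N, hN⟩ := exists_pow_lt_of_lt_one (lt_min hε hδ) (by norm_num : (1 / 2 : ℝ) < 1)
  obtain ⟨k, hkN, hk⟩ := exists_slope_eq q N
  have hpow : (1 : ℝ) / 2 ^ k < min ε δ := by
    rw [← one_div_pow]
    exact (pow_le_pow_of_le_one (by norm_num) (by norm_num) hkN).trans_lt hN
  have hlen : (1 : ℝ) / freq k < δ := by
    refine lt_of_le_of_lt ?_ (hpow.trans_le (min_le_right _ _))
    have : ((2 : ℝ) ^ k) ≤ freq k := by exact_mod_cast two_pow_le_freq k
    gcongr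
  have hy := floor_mul_freq_eq_iff.1 (rfl : ⌊y * freq k⌋ = ⌊y * freq k⌋)
  set j := ⌊y * freq k⌋
  rw [node_succ] at hy
  have bound (z : ℝ) (hz : z ∈ Set.Icc (node k j) (node k j + 1 / freq k)) :
      |f z - f y - q * (z - y)| ≤ ε / 2 * |z - y| := by
    have hzy : |z - y| < δ := by
      rw [abs_lt]
      constructor <;> linarith [hz.1, hz.2, hy.1, hy.2]
    have h1 := hball (y := z) (by rwa [Real.dist_eq])
    simp only [Real.norm_eq_abs, smul_eq_mul] at h1
    have h2 : |(deriv f y - q) * (z - y)| ≤ ε / 4 * |z - y| := by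
      rw [abs_mul]
      gcongr
      rw [abs_le]
      constructor <;> linarith
    calc |f z - f y - q * (z - y)|
        = |(f z - f y - (z - y) * deriv f y) + (deriv f y - q) * (z - y)| := by congr 1; ring
      _ ≤ _ := (abs_add_le _ _).trans (by linarith)
  refine ⟨k, (hpow.trans_le (min_le_left _ _)).le, fun r hr => ?_⟩
  rw [node_succ] at hr
  have hn := freq_pos k
  have hr' := bound r ⟨hr.1.le, hr.2.le⟩
  have h0 := bound (node k j) ⟨le_rfl, by linarith [hr.1, hr.2]⟩
  have h1 : |(r : ℝ) - y| ≤ 1 / freq k := by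
    rw [abs_le]
    constructor <;> linarith [hr.1, hr.2, hy.1, hy.2]
  have h2 : |node k j - y| ≤ 1 / freq k := by
    rw [abs_le]
    constructor <;> linarith [hr.1, hr.2, hy.1, hy.2]
  calc |f r - f (node k j) - slope k * (r - node k j)|
      = |(f r - f y - q * (r - y)) - (f (node k j) - f y - q * (node k j - y))| := by
        rw [hk]; congr 1; ring
    _ ≤ ε / 2 * |(r : ℝ) - y| + ε / 2 * |node k j - y| := (abs_sub _ _).trans (add_le_add hr' h0)
    _ ≤ ε / 2 * (1 / freq k) + ε / 2 * (1 / freq k) := by gcongr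
    _ = ε / freq k := by ring

lemma IsGood.abs_sub_le {ε : ℝ} {f : ℝ → ℝ} {k : ℕ} {j : ℤ} (h : IsGood ε f k j)
    (hf : Continuous f) {y : ℝ} (hy : ⌊y * freq k⌋ = j) :
    |(f y - shift y) - (f (node k j) - shift (node k j))| ≤ 2 * ε / freq k := by
  have hn := freq_pos k
  have hlt : node k j < node k (j + 1) := by
    rw [node_succ]
    linarith [one_div_pos.2 hn]
  have hclosed : IsClosed {z | |f z - f (node k j) - slope k * (z - node k j)| ≤ ε / freq k} :=
    isClosed_le (by fun_prop) continuous_const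
  have hsub : Set.Icc (node k j) (node k (j + 1)) ⊆
      {z | |f z - f (node k j) - slope k * (z - node k j)| ≤ ε / freq k} := by
    rw [← closure_Ioo hlt.ne, hclosed.closure_subset_iff]
    refine (Rat.denseRange_cast.open_subset_closure_inter isOpen_Ioo).trans
      (hclosed.closure_subset_iff.2 ?_)
    rintro _ ⟨hz, q, rfl⟩
    exact h.2 q hz
  have h1 := hsub (Set.Ico_subset_Icc_self (floor_mul_freq_eq_iff.1 hy))
  have h2 := abs_shift_sub_le k (hy.trans (floor_node_mul_freq k j).symm)
  have h3 : 1 / (freq k * 2 ^ k : ℝ) ≤ ε / freq k := by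
    rw [mul_comm, ← div_div]
    gcongr
    exact h.1
  rw [Set.mem_ofPred_eq] at h1
  calc |(f y - shift y) - (f (node k j) - shift (node k j))|
      = |(f y - f (node k j) - slope k * (y - node k j)) -
          (shift y - shift (node k j) - slope k * (y - node k j))| := by congr 1; ring
    _ ≤ ε / freq k + ε / freq k := (abs_sub _ _).trans (add_le_add h1 (h2.trans h3))
    _ = _ := by ring

lemma node_mem_Ico {k : ℕ} {y : ℝ} {a : ℤ} (hy : ⌊y⌋ = a) :
    node k ⌊y * freq k⌋ ∈ Set.Ico (a : ℝ) (a + 1) := by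
  have h := floor_mul_freq_eq (Nat.zero_le k) (floor_node_mul_freq k ⌊y * freq k⌋)
  simp only [freq, Finset.range_zero, Finset.prod_empty, Nat.cast_one, mul_one] at h
  exact Int.floor_eq_iff.1 (h.trans hy)

lemma sub_shift_mem_imageCover {ε : ℝ} (hε : 0 < ε) {f : ℝ → ℝ} (hf : Differentiable ℝ f) (y : ℝ) :
    f y - shift y ∈ imageCover ε f ⌊y⌋ := by
  classical
  have h := exists_isGood (hf y) hε
  have hfind := Nat.find_spec h
  have hmin := fun i (hi : i < Nat.find h) => Nat.find_min h hi
  set k := Nat.find h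
  refine Set.mem_biUnion (x := (k, ⌊y * freq k⌋)) ⟨node_mem_Ico rfl, hfind, fun i hi => ?_⟩ ?_
  · rw [floor_mul_freq_eq hi.le (floor_node_mul_freq k ⌊y * freq k⌋)]
    exact hmin i hi
  · rw [Metric.mem_closedBall, Real.dist_eq]
    exact hfind.abs_sub_le hf.continuous rfl

lemma pairwiseDisjoint_maximalCells (ε : ℝ) (f : ℝ → ℝ) (a : ℤ) :
    (maximalCells ε f a).PairwiseDisjoint
      fun p => Set.Ico (node p.1 p.2) (node p.1 (p.2 + 1)) := by
  have key {p q : ℕ × ℤ} {y : ℝ} (hp : p ∈ maximalCells ε f a) (hq : q ∈ maximalCells ε f a)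
      (hyp : ⌊y * freq p.1⌋ = p.2) (hyq : ⌊y * freq q.1⌋ = q.2) : ¬ q.1 < p.1 := by
    intro hlt
    refine hp.2.2 _ hlt ?_
    rw [floor_mul_freq_eq hlt.le ((floor_node_mul_freq p.1 p.2).trans hyp.symm), hyq]
    exact hq.2.1
  intro p hp q hq hpq
  refine Set.disjoint_left.2 fun y hyp hyq => hpq ?_
  rw [← floor_mul_freq_eq_iff] at hyp hyq
  have h1 : p.1 = q.1 := le_antisymm (not_lt.1 (key hp hq hyp hyq)) (not_lt.1 (key hq hp hyq hyp))
  exact Prod.ext h1 (by rw [← hyp, ← hyq, h1])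

lemma volume_imageCover_le {ε : ℝ} (hε : 0 ≤ ε) (f : ℝ → ℝ) (a : ℤ) :
    volume (imageCover ε f a) ≤ ENNReal.ofReal (4 * ε) * 2 := by
  have hcount := (maximalCells ε f a).to_countable
  calc volume (imageCover ε f a)
      ≤ ∑' p : maximalCells ε f a, volume (Metric.closedBall
          (f (node p.1.1 p.1.2) - shift (node p.1.1 p.1.2)) (2 * ε / freq p.1.1)) :=
        measure_biUnion_le _ hcount _
    _ = ∑' p : maximalCells ε f a, ENNReal.ofReal (4 * ε) *
          volume (Set.Ico (node p.1.1 p.1.2) (node p.1.1 (p.1.2 + 1))) := by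
        refine tsum_congr fun p => ?_
        rw [Real.volume_closedBall, Real.volume_Ico, node_succ,
          ← ENNReal.ofReal_mul (by positivity)]
        congr 1
        ring
    _ = ENNReal.ofReal (4 * ε) * volume (⋃ p ∈ maximalCells ε f a,
          Set.Ico (node p.1 p.2) (node p.1 (p.2 + 1))) := by
        rw [ENNReal.tsum_mul_left, measure_biUnion hcount (pairwiseDisjoint_maximalCells ε f a)
          fun _ _ => measurableSet_Ico]
    _ ≤ ENNReal.ofReal (4 * ε) * volume (Set.Ico (a : ℝ) (a + 2)) := by
        gcongr
        refine Set.iUnion₂_subset fun p hp => Set.Ico_subset_Ico hp.1.1 ?_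
        have := (div_le_one (freq_pos p.1)).2 (one_le_freq p.1)
        rw [node_succ]
        linarith [hp.1.2]
    _ = _ := by rw [Real.volume_Ico, add_sub_cancel_left, ENNReal.ofReal_ofNat]

section Parametric

variable {T : Type*} [MeasurableSpace T] {g : ℝ × T → ℝ}

lemma measurableSet_setOf_isGood (hg : Measurable g) (ε : ℝ) (k : ℕ) (j : ℤ) :
    MeasurableSet {t | IsGood ε (fun y => g (y, t)) k j} := by
  have hq (q : ℚ) : MeasurableSet {t |
      |g (q, t) - g (node k j, t) - slope k * (q - node k j)| ≤ ε / freq k} :=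
    measurableSet_le (by fun_prop) measurable_const
  exact measurableSet_setOfPred.2 <| measurable_const.and <| .forall fun q =>
    measurable_const.imp (measurableSet_setOfPred.1 (hq q))

lemma measurableSet_setOf_imageCover (hg : Measurable g) (ε : ℝ) (a : ℤ) :
    MeasurableSet {xt : ℝ × T | xt.1 ∈ imageCover ε (fun y => g (y, xt.2)) a} := by
  have heq : {xt : ℝ × T | xt.1 ∈ imageCover ε (fun y => g (y, xt.2)) a} =
      ⋃ p : ℕ × ℤ, {xt | p ∈ maximalCells ε (fun y => g (y, xt.2)) a} ∩
        {xt | dist xt.1 (g (node p.1 p.2, xt.2) - shift (node p.1 p.2)) ≤ 2 * ε / freq p.1} := by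
    ext xt
    simp [imageCover]
  rw [heq]
  refine .iUnion fun p => .inter ?_ (measurableSet_le (by fun_prop) measurable_const)
  have hgood (k : ℕ) (j : ℤ) :
      MeasurableSet {xt : ℝ × T | IsGood ε (fun y => g (y, xt.2)) k j} :=
    measurable_snd (measurableSet_setOf_isGood hg ε k j)
  exact measurableSet_setOfPred.2 <| measurable_const.and <|
    (measurableSet_setOfPred.1 (hgood _ _)).and <| .forall fun i =>
      measurable_const.imp (measurableSet_setOfPred.1 (hgood _ _)).not

/-- The translates by `shift` of the members of a family of graphs, depending differentiably on
the parameter, lie in a null set. -/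
theorem prod_setOf_exists_eq_sub_shift (μ : Measure T) [SFinite μ] (hg : Measurable g)
    (hdiff : ∀ᵐ t ∂μ, Differentiable ℝ fun y => g (y, t)) :
    (volume.prod μ) {xt : ℝ × T | ∃ y : ℝ, xt.1 = g (y, xt.2) - shift y} = 0 := by
  let ε (m : ℕ) : ℝ := 1 / (m + 1)
  have hε (m : ℕ) : 0 < ε m := Nat.one_div_pos_of_nat
  let F (a : ℤ) : Set (ℝ × T) :=
    ⋂ m : ℕ, {xt | xt.1 ∈ imageCover (ε m) (fun y => g (y, xt.2)) a}
  have hF (a : ℤ) : volume.prod μ (F a) = 0 := by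
    rw [Measure.prod_apply_symm (.iInter fun m => measurableSet_setOf_imageCover hg _ a)]
    refine lintegral_eq_zero_of_ae_eq_zero (.of_forall fun t => ?_)
    have hle (m : ℕ) : volume ((fun x => (x, t)) ⁻¹' F a) ≤ ENNReal.ofReal (4 * ε m) * 2 := by
      refine le_trans (measure_mono ?_) (volume_imageCover_le (hε m).le (fun y => g (y, t)) a)
      exact fun x hx => Set.mem_iInter.1 hx m
    have hlim : Filter.Tendsto (fun m => ENNReal.ofReal (4 * ε m) * 2) Filter.atTop (nhds 0) := by
      have h1 : Filter.Tendsto (fun m => 4 * ε m) Filter.atTop (nhds (4 * 0)) :=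
        tendsto_one_div_add_atTop_nhds_zero_nat.const_mul 4
      simpa using ENNReal.Tendsto.mul_const (ENNReal.tendsto_ofReal h1)
        (Or.inr (ENNReal.ofNat_ne_top (n := 2)))
    exact le_antisymm (ge_of_tendsto' hlim hle) bot_le
  have hN : (volume : Measure ℝ).prod μ
      (Set.univ ×ˢ {t | ¬ Differentiable ℝ fun y => g (y, t)}) = 0 := by
    rw [Measure.prod_prod, ae_iff.1 hdiff, mul_zero]
  refine measure_mono_null ?_ (measure_union_null hN (measure_iUnion_null hF))
  rintro ⟨x, t⟩ ⟨y, rfl : x = g (y, t) - shift y⟩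
  by_cases ht : Differentiable ℝ fun y => g (y, t)
  · exact .inr (Set.mem_iUnion.2 ⟨⌊y⌋, Set.mem_iInter.2 fun m =>
      sub_shift_mem_imageCover (hε m) ht y⟩)
  · exact .inl ⟨trivial, ht⟩

end Parametric

end Sawyer

/-- Sawyer's theorem: there is a universal function `ψ : ℝ → ℝ` such that for every `n ≥ 1`
and every Borel measurable `g : ℝ × ℝ^{n-1} → ℝ` with `y ↦ g (y, t)` of class `C¹` for
a.e. `t`, the union over `y` of the translated hypersurfaces `{x = g (y, t) - ψ y}` is a
Lebesgue null subset of `ℝ × ℝ^{n-1}`. -/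
theorem sawyer_universal_translation :
    ∃ ψ : ℝ → ℝ, ∀ n : ℕ, 0 < n →
      ∀ g : ℝ × (Fin (n - 1) → ℝ) → ℝ, Measurable g →
        (∀ᵐ t : Fin (n - 1) → ℝ, ContDiff ℝ 1 (fun y : ℝ => g (y, t))) →
        volume {xt : ℝ × (Fin (n - 1) → ℝ) | ∃ y : ℝ, xt.1 = g (y, xt.2) - ψ y} = 0 := by
  refine ⟨Sawyer.shift, fun n _ g hg hdiff => ?_⟩
  exact Sawyer.prod_setOf_exists_eq_sub_shift volume hg
    (hdiff.mono fun t ht => ht.differentiable one_ne_zero)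
end

section
/- For every pair of positive integers p and q there exists a function ψ : ℝ^p → ℝ^q with the following property. Let n, d be positive integers with d < n and p ≤ n − d ≤ q, and let f : ℝ^p × ℝ^q → ℝ^{n−d} be C¹ such that at every point (y, ω) the Jacobian ∂f/∂ω(y, ω) (as a linear map ℝ^q → ℝ^{n−d}) is surjective (has full rank n − d), and such that the map (y, ω) ↦ ∂f/∂ω(y, ω) is Lipschitz. Then the range of the map y ↦ f(y, ψ(y)), i.e. the set { f(y, ψ(y)) : y ∈ ℝ^p } ⊆ ℝ^{n−d}, has (n−d)-dimensional Lebesgue measure zero. -/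
open MeasureTheory

/-- The side length `2 ^ (-k²)` of the grid of level `k`. -/
noncomputable def gridSize (k : ℕ) : ℝ := (2 ^ k ^ 2)⁻¹

/-- The index of the cell of the grid of level `k` that contains `y`. -/
noncomputable def gridIndex {ι : Type*} (k : ℕ) (y : ι → ℝ) : ι → ℤ :=
  fun i => ⌊2 ^ k ^ 2 * y i⌋

/-- The lower corner of the cell of the grid of level `k` that contains `y`. -/
noncomputable def gridCorner {ι : Type*} (k : ℕ) (y : ι → ℝ) : ι → ℝ :=
  fun i => gridSize k * gridIndex k y i

lemma gridSize_pos (k : ℕ) : 0 < gridSize k := by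
  unfold gridSize
  positivity

lemma gridSize_le_one (k : ℕ) : gridSize k ≤ 1 :=
  inv_le_one_of_one_le₀ (one_le_pow₀ (by norm_num))

lemma two_pow_mul_gridSize_add (k i : ℕ) :
    2 ^ (k + 1 + i) * gridSize (k + 1 + i) ≤ (1 / 2) ^ i * ((1 / 2) ^ k * gridSize k) := by
  have h : (2 : ℝ) ^ (k + 1 + i) * 2 ^ (i + k + k ^ 2) ≤ 2 ^ (k + 1 + i) ^ 2 := by
    rw [← pow_add]
    exact pow_le_pow_right₀ (by norm_num) (by nlinarith)
  have e : (1 / 2 : ℝ) ^ i * ((1 / 2) ^ k * gridSize k) = (2 ^ (i + k + k ^ 2))⁻¹ := by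
    simp only [gridSize, one_div, inv_pow, pow_add, mul_inv]
    ring
  rw [e, gridSize, ← div_eq_mul_inv, div_le_iff₀ (by positivity), ← div_eq_inv_mul,
    le_div_iff₀ (by positivity)]
  exact h

lemma two_pow_mul_gridSize_succ (k : ℕ) :
    2 ^ k * gridSize (k + 1) ≤ (1 / 2) ^ k * gridSize k := by
  have h := two_pow_mul_gridSize_add k 0
  have h' : (2 : ℝ) ^ k ≤ 2 ^ (k + 1) := pow_le_pow_right₀ (by norm_num) (by omega)
  have := mul_le_mul_of_nonneg_right h' (gridSize_pos (k + 1)).le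
  simp only [add_zero, pow_zero, one_mul] at h
  linarith

section Grid

variable {ι : Type*}

lemma gridIndex_eq_of_le {j k : ℕ} (hjk : j ≤ k) {y y' : ι → ℝ}
    (h : gridIndex k y' = gridIndex k y) : gridIndex j y' = gridIndex j y := by
  have key : ∀ x : ι → ℝ, ∀ i, gridIndex j x i = gridIndex k x i / (2 ^ (k ^ 2 - j ^ 2) : ℕ) := by
    intro x i
    have hsq : j ^ 2 ≤ k ^ 2 := Nat.pow_le_pow_left hjk 2
    rw [gridIndex, gridIndex, ← Int.floor_div_natCast]
    congr 1
    rw [eq_div_iff (by positivity)]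
    push_cast
    rw [mul_right_comm, ← pow_add, Nat.add_sub_cancel' hsq]
  funext i
  rw [key, key, h]

lemma gridCorner_eq_of_le {j k : ℕ} (hjk : j ≤ k) {y y' : ι → ℝ}
    (h : gridIndex k y' = gridIndex k y) : gridCorner j y' = gridCorner j y := by
  unfold gridCorner
  rw [gridIndex_eq_of_le hjk h]

lemma gridCell_eq_pi_Ico (k : ℕ) (z : ι → ℤ) :
    {y : ι → ℝ | gridIndex k y = z} =
      Set.univ.pi fun i => Set.Ico (gridSize k * z i) (gridSize k * z i + gridSize k) := by
  ext y
  simp only [Set.mem_ofPred_eq, Set.mem_pi, Set.mem_univ, true_imp_iff, Set.mem_Ico, funext_iff,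
    gridIndex, Int.floor_eq_iff, gridSize]
  refine forall_congr' fun i => and_congr ?_ ?_
  · rw [inv_mul_le_iff₀ (by positivity)]
  · rw [← mul_add_one, lt_inv_mul_iff₀ (by positivity)]

lemma mem_Ico_sub_gridCorner (k : ℕ) (y : ι → ℝ) (i : ι) :
    y i - gridCorner k y i ∈ Set.Ico 0 (gridSize k) := by
  have h : y ∈ {x : ι → ℝ | gridIndex k x = gridIndex k y} := rfl
  rw [gridCell_eq_pi_Ico] at h
  have := h i (Set.mem_univ i)
  simp only [gridCorner, Set.mem_Ico] at this ⊢
  constructor <;> linarith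

variable [Fintype ι]

lemma measurableSet_gridCell (k : ℕ) (z : ι → ℤ) :
    MeasurableSet {y : ι → ℝ | gridIndex k y = z} := by
  rw [gridCell_eq_pi_Ico]
  exact MeasurableSet.univ_pi fun _ => measurableSet_Ico

lemma volume_gridCell (k : ℕ) (z : ι → ℤ) :
    volume {y : ι → ℝ | gridIndex k y = z} = ENNReal.ofReal (gridSize k) ^ Fintype.card ι := by
  rw [gridCell_eq_pi_Ico, Real.volume_pi_Ico]
  simp

lemma norm_sub_gridCorner_le (k : ℕ) (y : ι → ℝ) : ‖y - gridCorner k y‖ ≤ gridSize k := by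
  refine (pi_norm_le_iff_of_nonneg (gridSize_pos k).le).2 fun i => ?_
  have := mem_Ico_sub_gridCorner k y i
  rw [Pi.sub_apply, Real.norm_of_nonneg this.1]
  exact this.2.le

lemma norm_sub_le_of_gridIndex_eq {k : ℕ} {y y' : ι → ℝ}
    (h : gridIndex k y' = gridIndex k y) : ‖y' - y‖ ≤ gridSize k := by
  refine (pi_norm_le_iff_of_nonneg (gridSize_pos k).le).2 fun i => ?_
  have h1 := mem_Ico_sub_gridCorner k y i
  have h2 := mem_Ico_sub_gridCorner k y' i
  rw [gridCorner_eq_of_le le_rfl h] at h2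
  rw [Pi.sub_apply, Real.norm_eq_abs, abs_le]
  constructor <;> linarith [h1.1, h1.2, h2.1, h2.2]

/-- A map that contracts, around every point and for every `ε`, some cell of the grid by the
factor `ε` has null image, as long as the dimension does not drop. -/
theorem volume_range_eq_zero_of_gridCell_contracting {κ : Type*} [Fintype κ] [Nonempty κ]
    (hcard : Fintype.card ι ≤ Fintype.card κ) (g : (ι → ℝ) → κ → ℝ)
    (hg : ∀ ε > 0, ∀ y, ∃ k, ∀ y', gridIndex k y' = gridIndex k y →
      ‖g y' - g y‖ ≤ ε * gridSize k) :
    volume (Set.range g) = 0 := by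
  classical
  have hcover : Set.range g = ⋃ z : ι → ℤ, g '' {y | gridIndex 0 y = z} := by
    rw [← Set.image_iUnion, ← Set.image_univ]
    congr 1
    ext y
    simp
  rw [hcover, measure_iUnion_null_iff]
  intro z
  have hsmall : ∀ ε : ℝ, 0 < ε → 2 * ε ≤ 1 →
      volume (g '' {y | gridIndex 0 y = z}) ≤ ENNReal.ofReal (2 * ε) := by
    intro ε hε hε1
    let P : (ι → ℝ) → ℕ → Prop := fun y k => ∃ x, ∀ y', gridIndex k y' = gridIndex k y →
      ‖g y' - g x‖ ≤ ε * gridSize k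
    have hP : ∀ y, ∃ k, P y k := fun y => (hg ε hε y).imp fun k hk => ⟨y, hk⟩
    let T : ℕ × (ι → ℤ) → Set (ι → ℝ) := fun a =>
      {y | gridIndex 0 y = z ∧ Nat.find (hP y) = a.1 ∧ gridIndex a.1 y = a.2}
    have hT : ∀ a, ∀ y ∈ T a, T a = {y' | gridIndex a.1 y' = a.2} := by
      rintro ⟨k, w⟩ y ⟨hy0, hyk, hyw⟩
      ext y'
      refine ⟨fun h => h.2.2, fun h => ?_⟩
      have hyy : gridIndex k y' = gridIndex k y := h.trans hyw.symm
      have hiff : ∀ j ≤ k, (P y' j ↔ P y j) := fun j hj => by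
        simp only [P, gridIndex_eq_of_le hj hyy]
      refine ⟨(gridIndex_eq_of_le (Nat.zero_le k) hyy).trans hy0, ?_, h⟩
      rw [Nat.find_eq_iff] at hyk ⊢
      exact ⟨(hiff k le_rfl).2 hyk.1, fun j hj => (hiff j hj.le).not.2 (hyk.2 j hj)⟩
    have hTmeas : ∀ a, MeasurableSet (T a) := by
      intro a
      rcases (T a).eq_empty_or_nonempty with h | ⟨y, hy⟩
      · rw [h]; exact MeasurableSet.empty
      · rw [hT a y hy]; exact measurableSet_gridCell _ _
    have hTdisj : Pairwise (Function.onFun Disjoint T) := by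
      rintro a b hab
      refine Set.disjoint_left.2 fun y ha hb => hab ?_
      have h1 : a.1 = b.1 := ha.2.1.symm.trans hb.2.1
      exact Prod.ext h1 (by rw [← ha.2.2, ← hb.2.2, h1])
    have hTunion : ⋃ a, T a = {y | gridIndex 0 y = z} := by
      ext y
      simp only [Set.mem_iUnion, Set.mem_ofPred_eq]
      exact ⟨fun ⟨a, ha⟩ => ha.1, fun h => ⟨(Nat.find (hP y), gridIndex _ y), h, rfl, rfl⟩⟩
    have himage : ∀ a, volume (g '' T a) ≤ ENNReal.ofReal (2 * ε) * volume (T a) := by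
      intro a
      rcases (T a).eq_empty_or_nonempty with h | ⟨y, hy⟩
      · simp [h]
      obtain ⟨x, hx⟩ : P y a.1 := hy.2.1 ▸ Nat.find_spec (hP y)
      have hsub : g '' T a ⊆ Metric.closedBall (g x) (ε * gridSize a.1) := by
        rintro _ ⟨y', hy', rfl⟩
        rw [mem_closedBall_iff_norm]
        exact hx y' (hy'.2.2.trans hy.2.2.symm)
      have hs := gridSize_pos a.1
      calc volume (g '' T a) ≤ volume (Metric.closedBall (g x) (ε * gridSize a.1)) :=
            measure_mono hsub
        _ = ENNReal.ofReal (2 * ε) ^ Fintype.card κ *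
              ENNReal.ofReal (gridSize a.1) ^ Fintype.card κ := by
            rw [Real.volume_pi_closedBall _ (by positivity), ← mul_assoc, mul_pow,
              ENNReal.ofReal_mul (by positivity), ENNReal.ofReal_pow (by positivity),
              ENNReal.ofReal_pow hs.le]
        _ ≤ ENNReal.ofReal (2 * ε) * ENNReal.ofReal (gridSize a.1) ^ Fintype.card ι := by
            refine mul_le_mul' (pow_le_of_le_one (zero_le) ?_ Fintype.card_ne_zero)
              (pow_le_pow_of_le_one (zero_le) ?_ hcard)
            · exact ENNReal.ofReal_le_one.2 hε1
            · exact ENNReal.ofReal_le_one.2 (gridSize_le_one a.1)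
        _ = ENNReal.ofReal (2 * ε) * volume (T a) := by
            rw [hT a y hy, volume_gridCell]
    calc volume (g '' {y | gridIndex 0 y = z}) = volume (⋃ a, g '' T a) := by
          rw [← hTunion, Set.image_iUnion]
      _ ≤ ∑' a, volume (g '' T a) := measure_iUnion_le _
      _ ≤ ∑' a, ENNReal.ofReal (2 * ε) * volume (T a) := ENNReal.tsum_le_tsum himage
      _ = ENNReal.ofReal (2 * ε) * volume {y : ι → ℝ | gridIndex 0 y = z} := by
          rw [ENNReal.tsum_mul_left, ← measure_iUnion hTdisj hTmeas, hTunion]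
      _ = ENNReal.ofReal (2 * ε) := by
          rw [volume_gridCell]
          simp [gridSize]
  refine le_antisymm (ENNReal.le_of_forall_pos_le_add fun δ hδ _ => ?_) (zero_le)
  have hpos : 0 < min (δ : ℝ) 1 := lt_min (by exact_mod_cast hδ) one_pos
  have h := hsmall (min (δ : ℝ) 1 / 2) (by positivity) (by linarith [min_le_right (δ : ℝ) 1])
  rw [zero_add]
  refine h.trans ?_
  rw [mul_div_cancel₀ _ two_ne_zero, ← ENNReal.ofReal_coe_nnreal]
  exact ENNReal.ofReal_le_ofReal (min_le_left _ _)

end Grid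

/-- A sequence that comes back near every point infinitely often, at controlled speed. -/
lemma exists_recurrent_seq (V : Type*) [NormedAddCommGroup V]
    [TopologicalSpace.SeparableSpace V] :
    ∃ S : ℕ → V, (∀ j, ‖S j‖ ≤ 2 ^ j) ∧ ∀ T, ∀ ε > 0, ∀ K, ∃ k ≥ K, ‖S k - T‖ < ε := by
  classical
  let D := TopologicalSpace.denseSeq V
  refine ⟨fun j => if ‖D j.unpair.1‖ ≤ 2 ^ j then D j.unpair.1 else 0, fun j => ?_,
    fun T ε hε K => ?_⟩
  · dsimp only
    split_ifs with h
    · exact h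
    · simp
  · obtain ⟨i, hi⟩ := (TopologicalSpace.denseRange_denseSeq V).exists_dist_lt T hε
    obtain ⟨b, hb⟩ := pow_unbounded_of_one_lt ‖D i‖ (one_lt_two (α := ℝ))
    have hle : max b K ≤ Nat.pair i (max b K) := Nat.right_le_pair _ _
    refine ⟨Nat.pair i (max b K), (le_max_right _ _).trans hle, ?_⟩
    have hnorm : ‖D i‖ ≤ 2 ^ Nat.pair i (max b K) :=
      hb.le.trans (pow_le_pow_right₀ one_le_two ((le_max_left _ _).trans hle))
    simp only [Nat.unpair_pair, if_pos hnorm]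
    rwa [← dist_eq_norm, dist_comm]

section Staircase

variable {ι F : Type*} [Fintype ι] [NormedAddCommGroup F] [NormedSpace ℝ F]

/-- The function which on the grid of level `j` looks like the linear map `S j`. -/
noncomputable def staircase (S : ℕ → (ι → ℝ) →L[ℝ] F) (y : ι → ℝ) : F :=
  ∑' j, S j (gridCorner (j + 1) y - gridCorner j y)

lemma norm_staircase_term_le {S : ℕ → (ι → ℝ) →L[ℝ] F} (hS : ∀ j, ‖S j‖ ≤ 2 ^ j)
    (k i : ℕ) (y : ι → ℝ) :
    ‖S (k + 1 + i) (gridCorner (k + 1 + i + 1) y - gridCorner (k + 1 + i) y)‖ ≤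
      2 * ((1 / 2) ^ k * gridSize k) * (1 / 2) ^ i := by
  set j := k + 1 + i with hj
  have hmono : gridSize (j + 1) ≤ gridSize j :=
    inv_anti₀ (by positivity) (pow_le_pow_right₀ one_le_two (by gcongr; omega))
  have hc : ‖gridCorner (j + 1) y - gridCorner j y‖ ≤ 2 * gridSize j := by
    have h := norm_sub_le (y - gridCorner j y) (y - gridCorner (j + 1) y)
    rw [sub_sub_sub_cancel_left] at h
    linarith [norm_sub_gridCorner_le j y, norm_sub_gridCorner_le (j + 1) y]
  calc _ ≤ 2 ^ j * (2 * gridSize j) := (S j).le_of_opNorm_le_of_le (hS j) hc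
    _ ≤ _ := by linarith [two_pow_mul_gridSize_add k i]

lemma norm_staircase_sub_le [CompleteSpace F] {S : ℕ → (ι → ℝ) →L[ℝ] F}
    (hS : ∀ j, ‖S j‖ ≤ 2 ^ j) {k : ℕ} {y y' : ι → ℝ} (h : gridIndex k y' = gridIndex k y) :
    ‖staircase S y' - staircase S y - S k (y' - y)‖ ≤ 10 * ((1 / 2) ^ k * gridSize k) := by
  let t : (ι → ℝ) → ℕ → F := fun x j => S j (gridCorner (j + 1) x - gridCorner j x)
  let b : ℝ := (1 / 2) ^ k * gridSize k
  have hgeom : HasSum (fun i : ℕ => 2 * b * (1 / 2 : ℝ) ^ i) (2 * b * 2) :=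
    hasSum_geometric_two.mul_left _
  have hterm : ∀ x i, ‖t x (i + (k + 1))‖ ≤ 2 * b * (1 / 2) ^ i := fun x i => by
    rw [add_comm i]
    exact norm_staircase_term_le hS k i x
  have hsum : ∀ x, Summable (t x) := fun x =>
    (summable_nat_add_iff (k + 1)).1 (Summable.of_norm_bounded hgeom.summable (hterm x))
  have htail : ∀ x, ‖∑' i, t x (i + (k + 1))‖ ≤ 2 * b * 2 := fun x =>
    tsum_of_norm_bounded hgeom (hterm x)
  have hsplit : ∀ x, staircase S x =
      ∑ j ∈ Finset.range k, t x j + t x k + ∑' i, t x (i + (k + 1)) := fun x => by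
    rw [← Finset.sum_range_succ, (hsum x).sum_add_tsum_nat_add]
    rfl
  have hhead : ∑ j ∈ Finset.range k, t y' j = ∑ j ∈ Finset.range k, t y j :=
    Finset.sum_congr rfl fun j hj => by
      have hjk := Finset.mem_range.1 hj
      simp only [t, gridCorner_eq_of_le hjk.le h, gridCorner_eq_of_le (Nat.succ_le_of_lt hjk) h]
  have hmid : ∀ x, ‖S k (x - gridCorner (k + 1) x)‖ ≤ b := fun x =>
    ((S k).le_of_opNorm_le_of_le (hS k) (norm_sub_gridCorner_le (k + 1) x)).trans
      (two_pow_mul_gridSize_succ k)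
  have hdecomp : staircase S y' - staircase S y - S k (y' - y) =
      (S k (y - gridCorner (k + 1) y) - S k (y' - gridCorner (k + 1) y')) +
        (∑' i, t y' (i + (k + 1)) - ∑' i, t y (i + (k + 1))) := by
    rw [hsplit, hsplit, hhead]
    simp only [t, gridCorner_eq_of_le le_rfl h, map_sub]
    abel
  rw [hdecomp]
  have h1 := norm_add_le (S k (y - gridCorner (k + 1) y) - S k (y' - gridCorner (k + 1) y'))
    (∑' i, t y' (i + (k + 1)) - ∑' i, t y (i + (k + 1)))
  have h2 := norm_sub_le (S k (y - gridCorner (k + 1) y)) (S k (y' - gridCorner (k + 1) y'))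
  have h3 := norm_sub_le (∑' i, t y' (i + (k + 1))) (∑' i, t y (i + (k + 1)))
  have hb : (1 / 2) ^ k * gridSize k = b := rfl
  linarith [hmid y, hmid y', htail y, htail y']

lemma tendsto_gridSize : Filter.Tendsto gridSize Filter.atTop (nhds 0) := by
  refine squeeze_zero (fun k => (gridSize_pos k).le) (fun k => ?_)
    (tendsto_pow_atTop_nhds_zero_of_lt_one (r := (1 / 2 : ℝ)) (by norm_num) (by norm_num))
  rw [gridSize, one_div, inv_pow]
  exact inv_anti₀ (by positivity)
    (pow_le_pow_right₀ one_le_two (Nat.le_self_pow two_ne_zero k))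

/-- If the slopes `S k` recur near every linear map, then a map `f` that is submersive in its
second variable contracts arbitrarily small cells along the graph of the staircase. -/
lemma exists_gridCell_contracting [FiniteDimensional ℝ F] {G : Type*} [NormedAddCommGroup G]
    [NormedSpace ℝ G] [FiniteDimensional ℝ G] {S : ℕ → (ι → ℝ) →L[ℝ] F}
    (hS : ∀ j, ‖S j‖ ≤ 2 ^ j) (hrec : ∀ T, ∀ ε > 0, ∀ K, ∃ k ≥ K, ‖S k - T‖ < ε)
    {f : (ι → ℝ) → F → G} {y : ι → ℝ}
    (hf : DifferentiableAt ℝ (fun x : (ι → ℝ) × F => f x.1 x.2) (y, staircase S y))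
    (hsurj : Function.Surjective (fderiv ℝ (f y) (staircase S y))) {ε : ℝ} (hε : 0 < ε) :
    ∃ k, ∀ y', gridIndex k y' = gridIndex k y →
      ‖f y' (staircase S y') - f y (staircase S y)‖ ≤ ε * gridSize k := by
  have : CompleteSpace F := FiniteDimensional.complete ℝ F
  obtain ⟨L, hL⟩ := hf
  set B := L.comp (ContinuousLinearMap.inr ℝ (ι → ℝ) F) with hB
  have hfd : HasFDerivAt (f y) B (staircase S y) :=
    hL.comp (f := fun w : F => (y, w)) (staircase S y) (hasFDerivAt_prodMk_right y _)
  rw [hfd.fderiv] at hsurj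
  obtain ⟨R, hR⟩ := (B : F →ₗ[ℝ] G).exists_rightInverse_of_surjective
    (LinearMap.range_eq_top.2 hsurj)
  have hBR : ∀ v, B (R v) = v := fun v => LinearMap.congr_fun hR v
  let T : (ι → ℝ) →L[ℝ] F :=
    -((LinearMap.toContinuousLinearMap R).comp (L.comp (ContinuousLinearMap.inl ℝ (ι → ℝ) F)))
  have hLT : ∀ u v, L (u, v) = B (v - T u) := fun u v => by
    have huv : L (u, v) = L (u, 0) + L (0, v) := by rw [← map_add]; simp
    have hT : B (T u) = -L (u, 0) := by simp [T, hBR]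
    have hv : B v = L (0, v) := by simp [hB]
    rw [map_sub, hT, hv, huv]
    abel
  set C : ℝ := ‖T‖ + 12 with hC
  have hC0 : 0 < C := by positivity
  set η : ℝ := ε / (2 * C) with hη
  have hη0 : 0 < η := by positivity
  obtain ⟨r, hr, hball⟩ := Metric.eventually_nhds_iff.1 (hL.isLittleO.def hη0)
  set ρ : ℝ := min 1 (ε / (22 * (‖B‖ + 1))) with hρ
  have hρ0 : 0 < ρ := by positivity
  have hev : ∀ᶠ k in Filter.atTop, (1 / 2 : ℝ) ^ k < ρ ∧ gridSize k < r / C :=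
    ((tendsto_pow_atTop_nhds_zero_of_lt_one (by norm_num) (by norm_num)).eventually_lt_const
      hρ0).and (tendsto_gridSize.eventually_lt_const (by positivity))
  obtain ⟨K, hK⟩ := Filter.eventually_atTop.1 hev
  obtain ⟨k, hkK, hk⟩ := hrec T ρ hρ0 K
  obtain ⟨hpow, hsize⟩ := hK k hkK
  refine ⟨k, fun y' hy' => ?_⟩
  have hs := gridSize_pos k
  set u := y' - y with hu
  set v := staircase S y' - staircase S y with hv
  have hunorm : ‖u‖ ≤ gridSize k := norm_sub_le_of_gridIndex_eq hy'
  have hvT : ‖v - T u‖ ≤ 11 * ρ * gridSize k := by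
    have h1 : ‖v - S k u‖ ≤ 10 * ((1 / 2) ^ k * gridSize k) := norm_staircase_sub_le hS hy'
    have h2 : ‖(S k - T) u‖ ≤ ρ * gridSize k :=
      (S k - T).le_of_opNorm_le_of_le hk.le hunorm
    have h3 : v - T u = (v - S k u) + (S k - T) u := by
      rw [sub_apply]; abel
    rw [h3]
    have h4 := mul_le_mul_of_nonneg_right hpow.le hs.le
    linarith [norm_add_le (v - S k u) ((S k - T) u)]
  have hvnorm : ‖v‖ ≤ (‖T‖ + 11) * gridSize k := by
    have h1 : ‖T u‖ ≤ ‖T‖ * gridSize k := T.le_of_opNorm_le_of_le le_rfl hunorm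
    have h2 : ρ * gridSize k ≤ 1 * gridSize k :=
      mul_le_mul_of_nonneg_right (min_le_left _ _) hs.le
    have h3 := norm_add_le (v - T u) (T u)
    rw [sub_add_cancel] at h3
    linarith
  have huv : ‖(u, v)‖ ≤ C * gridSize k := by
    refine norm_prod_le_iff.2 ⟨?_, ?_⟩
    · have : 0 ≤ ‖T‖ * gridSize k := by positivity
      simp only [hC]
      linarith
    · simp only [hC]
      linarith
  have hpair : (y', staircase S y') - (y, staircase S y) = (u, v) := rfl
  have herr := hball (y := (y', staircase S y')) (by
    rw [dist_eq_norm, hpair]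
    refine huv.trans_lt ?_
    rwa [lt_div_iff₀ hC0, mul_comm] at hsize)
  simp only [hpair] at herr
  have hlin : ‖L (u, v)‖ ≤ ε / 2 * gridSize k := by
    rw [hLT]
    have hρB : ‖B‖ * (11 * ρ) ≤ ε / 2 := by
      have h1 : ρ * (22 * (‖B‖ + 1)) ≤ ε :=
        (le_div_iff₀ (by positivity)).1 (min_le_right _ _)
      linarith
    calc ‖B (v - T u)‖ ≤ ‖B‖ * (11 * ρ * gridSize k) := B.le_of_opNorm_le_of_le le_rfl hvT
      _ = ‖B‖ * (11 * ρ) * gridSize k := by ring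
      _ ≤ _ := mul_le_mul_of_nonneg_right hρB hs.le
  have hrem : η * ‖(u, v)‖ ≤ ε / 2 * gridSize k :=
    calc η * ‖(u, v)‖ ≤ η * (C * gridSize k) := mul_le_mul_of_nonneg_left huv hη0.le
      _ = ε / 2 * gridSize k := by rw [hη]; field_simp
  have htri := norm_add_le
    (f y' (staircase S y') - f y (staircase S y) - L (u, v)) (L (u, v))
  rw [sub_add_cancel] at htri
  linarith

end Staircase



/-- The slice lemma: for every `p, q` there is a universal `ψ : ℝ^p → ℝ^q` such that for all
`n, d` with `d < n` and `p ≤ n - d ≤ q`, and every `C¹` map `f : ℝ^p × ℝ^q → ℝ^{n-d}` whose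
partial Jacobian `∂f/∂ω` is everywhere surjective and Lipschitz in `(y, ω)`, the range of
`y ↦ f (y, ψ y)` is a Lebesgue null subset of `ℝ^{n-d}`. -/
theorem slice_lemma (p q : ℕ) (hp : 0 < p) (hq : 0 < q) :
    ∃ ψ : (Fin p → ℝ) → (Fin q → ℝ),
      ∀ n d : ℕ, 0 < n → 0 < d → d < n → p ≤ n - d → n - d ≤ q →
        ∀ f : (Fin p → ℝ) → (Fin q → ℝ) → (Fin (n - d) → ℝ),
          ContDiff ℝ 1 (fun yω : (Fin p → ℝ) × (Fin q → ℝ) => f yω.1 yω.2) →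
          (∀ (y : Fin p → ℝ) (ω : Fin q → ℝ),
            Function.Surjective (fderiv ℝ (f y) ω)) →
          (∃ K : NNReal, LipschitzWith K
            (fun yω : (Fin p → ℝ) × (Fin q → ℝ) => fderiv ℝ (f yω.1) yω.2)) →
          volume {z : Fin (n - d) → ℝ | ∃ y : Fin p → ℝ, z = f y (ψ y)} = 0 := by
  have : ProperSpace ((Fin p → ℝ) →L[ℝ] (Fin q → ℝ)) := FiniteDimensional.proper ℝ _
  obtain ⟨S, hS, hrec⟩ := exists_recurrent_seq ((Fin p → ℝ) →L[ℝ] (Fin q → ℝ))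
  refine ⟨staircase S, fun n d _ _ hdn hpm _ f hf hsurj _ => ?_⟩
  have : Nonempty (Fin (n - d)) := ⟨⟨0, Nat.sub_pos_of_lt hdn⟩⟩
  have hrange : {z : Fin (n - d) → ℝ | ∃ y : Fin p → ℝ, z = f y (staircase S y)} =
      Set.range fun y => f y (staircase S y) := by
    ext z
    simp [eq_comm]
  rw [hrange]
  refine volume_range_eq_zero_of_gridCell_contracting (by simpa using hpm) _ fun ε hε y => ?_
  exact exists_gridCell_contracting hS hrec (hf.differentiable one_ne_zero _) (hsurj y _) hε
end

section
/- There exists a function ψ : ℝ → ℝ such that for every C¹ function g : ℝ → ℝ, the set { g(y) − ψ(y) : y ∈ ℝ } has one-dimensional Lebesgue measure zero. -/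
open MeasureTheory

namespace SawtoothSum

/-- The increments of a sequence, starting from `0`. -/
def increment (s : ℕ → ℝ) : ℕ → ℝ
  | 0 => s 0
  | k + 1 => s (k + 1) - s k

lemma sum_increment (s : ℕ → ℝ) (n : ℕ) :
    ∑ k ∈ Finset.range (n + 1), increment s k = s n := by
  induction n with
  | zero => simp [increment]
  | succ n ih => rw [Finset.sum_range_succ, ih, increment]; ring

/-- Frequencies, each dividing the next, growing fast compared with the coefficients `d`. -/
noncomputable def scale (d : ℕ → ℝ) : ℕ → ℕ
  | 0 => 1
  | k + 1 => scale d k * (2 ^ (k + 1) * (⌈|d (k + 1)|⌉₊ + 1))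

/-- A sum of sawtooth waves of slopes `d k` and frequencies `scale d k`. -/
noncomputable def sawtoothSum (d : ℕ → ℝ) (y : ℝ) : ℝ :=
  ∑' k, d k * (Int.fract (scale d k * y) / scale d k)

/-- The `m`-th interval of length `1 / scale d n`. -/
def cell (d : ℕ → ℝ) (n : ℕ) (m : ℤ) : Set ℝ := {y | ⌊(scale d n : ℝ) * y⌋ = m}

variable (d : ℕ → ℝ)

lemma scale_pos (n : ℕ) : 0 < scale d n := by
  induction n with
  | zero => simp [scale]
  | succ n ih => rw [scale]; positivity

lemma scale_dvd {k n : ℕ} (h : k ≤ n) : scale d k ∣ scale d n := by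
  induction n, h using Nat.le_induction with
  | base => exact dvd_rfl
  | succ n _ ih => exact ih.trans (by rw [scale]; exact dvd_mul_right _ _)

lemma two_pow_le_scale (n : ℕ) : 2 ^ n ≤ scale d n := by
  cases n with
  | zero => simp [scale]
  | succ n =>
    rw [scale]
    have h := scale_pos d n
    calc 2 ^ (n + 1) = 1 * (2 ^ (n + 1) * 1) := by ring
      _ ≤ _ := by gcongr <;> omega

lemma abs_div_scale_succ_le (k : ℕ) :
    |d (k + 1)| / scale d (k + 1) ≤ 1 / scale d k / 2 ^ (k + 1) := by
  have h : (0 : ℝ) < scale d k := by exact_mod_cast scale_pos d k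
  have hc : |d (k + 1)| ≤ (⌈|d (k + 1)|⌉₊ : ℝ) + 1 := (Nat.le_ceil _).trans (by simp)
  rw [scale]
  push_cast
  rw [div_div, div_le_div_iff₀ (by positivity) (by positivity)]
  calc |d (k + 1)| * (scale d k * 2 ^ (k + 1))
      ≤ ((⌈|d (k + 1)|⌉₊ : ℝ) + 1) * (scale d k * 2 ^ (k + 1)) := by gcongr
    _ = _ := by ring

lemma abs_div_scale_add_le (n k : ℕ) :
    |d (k + (n + 1))| / scale d (k + (n + 1)) ≤ (1 / scale d n / 2 ^ n) / 2 / 2 ^ k := by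
  have h : (0 : ℝ) < scale d n := by exact_mod_cast scale_pos d n
  have hle : (scale d n : ℝ) ≤ scale d (k + n) := by
    exact_mod_cast Nat.le_of_dvd (scale_pos d _) (scale_dvd d (Nat.le_add_left n k))
  refine (abs_div_scale_succ_le d (k + n)).trans ?_
  calc 1 / (scale d (k + n) : ℝ) / 2 ^ (k + n + 1) ≤ 1 / (scale d n : ℝ) / 2 ^ (k + n + 1) := by
        gcongr
    _ = _ := by field_simp; ring

lemma summable_sawtooth (y : ℝ) :
    Summable fun k ↦ d k * (Int.fract (scale d k * y) / scale d k) := by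
  rw [← summable_nat_add_iff 1]
  refine Summable.of_norm_bounded (hasSum_geometric_two' _).summable fun k ↦
    le_trans ?_ (abs_div_scale_add_le d 0 k)
  rw [Real.norm_eq_abs, abs_mul, abs_div, Nat.abs_cast, Int.abs_fract,
    div_eq_mul_inv |_|, div_eq_mul_inv (Int.fract _), zero_add]
  have := (Int.fract_lt_one ((scale d (k + 1) : ℝ) * y)).le
  gcongr
  exact mul_le_of_le_one_left (by positivity) this

lemma floor_eq_of_mem_cell {k n : ℕ} (h : k ≤ n) {m : ℤ} {y z : ℝ}
    (hy : y ∈ cell d n m) (hz : z ∈ cell d n m) :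
    ⌊(scale d k : ℝ) * y⌋ = ⌊(scale d k : ℝ) * z⌋ := by
  obtain ⟨p, hp⟩ := scale_dvd d h
  have hp0 : (p : ℝ) ≠ 0 := by
    rintro h0
    have := scale_pos d n
    simp_all
  have key (x : ℝ) : ⌊(scale d k : ℝ) * x⌋ = ⌊(scale d n : ℝ) * x⌋ / p := by
    rw [← Int.floor_div_natCast, hp]
    congr 1
    push_cast
    field_simp
  rw [key, key, show ⌊_⌋ = m from hy, show ⌊_⌋ = m from hz]

lemma abs_sawtoothSum_sub_le {n : ℕ} {m : ℤ} {y z : ℝ}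
    (hy : y ∈ cell d n m) (hz : z ∈ cell d n m) :
    |sawtoothSum d y - sawtoothSum d z - (∑ k ∈ Finset.range (n + 1), d k) * (y - z)| ≤
      1 / scale d n / 2 ^ n := by
  have hs := (summable_sawtooth d y).sub (summable_sawtooth d z)
  rw [sawtoothSum, sawtoothSum, ← (summable_sawtooth d y).tsum_sub (summable_sawtooth d z),
    ← hs.sum_add_tsum_nat_add (n + 1), Finset.sum_mul]
  have h1 : ∑ k ∈ Finset.range (n + 1), (d k * (Int.fract (scale d k * y) / scale d k) -
      d k * (Int.fract (scale d k * z) / scale d k)) =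
      ∑ k ∈ Finset.range (n + 1), d k * (y - z) := by
    refine Finset.sum_congr rfl fun k hk ↦ ?_
    have h := floor_eq_of_mem_cell d (Finset.mem_range_succ_iff.1 hk) hy hz
    have h0 : (scale d k : ℝ) ≠ 0 := by exact_mod_cast (scale_pos d k).ne'
    rw [Int.fract, Int.fract, h]
    field_simp
    ring
  rw [h1, add_sub_cancel_left, ← Real.norm_eq_abs]
  refine tsum_of_norm_bounded (hasSum_geometric_two' _) fun k ↦
    le_trans ?_ (abs_div_scale_add_le d n k)
  rw [← mul_sub, ← sub_div, Real.norm_eq_abs, abs_mul, abs_div, Nat.abs_cast, ← mul_div_assoc]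
  gcongr
  refine mul_le_of_le_one_right (abs_nonneg _) (abs_le.2 ⟨?_, ?_⟩) <;>
  linarith [Int.fract_nonneg ((scale d (k + (n + 1)) : ℝ) * y),
    Int.fract_lt_one ((scale d (k + (n + 1)) : ℝ) * y),
    Int.fract_nonneg ((scale d (k + (n + 1)) : ℝ) * z),
    Int.fract_lt_one ((scale d (k + (n + 1)) : ℝ) * z)]

lemma cell_eq_Ico (n : ℕ) (m : ℤ) :
    cell d n m = Set.Ico (m / scale d n : ℝ) ((m + 1) / scale d n) := by
  have h : (0 : ℝ) < scale d n := by exact_mod_cast scale_pos d n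
  ext y
  rw [cell, Set.mem_ofPred_eq, Int.floor_eq_iff, Set.mem_Ico, div_le_iff₀ h, lt_div_iff₀ h,
    mul_comm y]

lemma abs_sub_le_of_mem_cell {n : ℕ} {m : ℤ} {y z : ℝ}
    (hy : y ∈ cell d n m) (hz : z ∈ cell d n m) : |y - z| ≤ 1 / scale d n := by
  rw [cell_eq_Ico, Set.mem_Ico, add_div] at hy hz
  rw [abs_le]
  constructor <;> linarith

lemma cell_subset_iUnion {k n p : ℕ} (hp : scale d n = scale d k * p) (m : ℤ) :
    cell d k m ⊆ ⋃ i ∈ Finset.range p, cell d n (m * p + i) := by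
  intro y hy
  have hp0 : 0 < p := Nat.pos_of_ne_zero fun h0 ↦ by
    have := scale_pos d n
    simp_all
  have hpR : (p : ℝ) ≠ 0 := by exact_mod_cast hp0.ne'
  have key : m = ⌊(scale d n : ℝ) * y⌋ / p := by
    rw [← show ⌊_⌋ = m from hy, ← Int.floor_div_natCast, hp]
    congr 1
    push_cast
    field_simp
  have hpZ : (0 : ℤ) < p := by exact_mod_cast hp0
  have h1 := Int.emod_nonneg ⌊(scale d n : ℝ) * y⌋ hpZ.ne'
  have h2 := Int.emod_lt_of_pos ⌊(scale d n : ℝ) * y⌋ hpZ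
  simp only [Set.mem_iUnion, Finset.mem_range]
  refine ⟨(⌊(scale d n : ℝ) * y⌋ % p).toNat, by omega, ?_⟩
  rw [cell, Set.mem_ofPred_eq, Int.toNat_of_nonneg h1, key, Int.ediv_mul_add_emod]

/-- A bound for the measure of images, proportional to the length of cells, passes from the
cells of one generation to those of a previous one. -/
lemma volume_image_cell_le {F : ℝ → ℝ} {c : ℝ} {k n : ℕ} (hkn : k ≤ n) {m : ℤ}
    (h : ∀ j, (cell d n j ∩ cell d k m).Nonempty →
      volume (F '' (cell d n j ∩ cell d k m)) ≤ ENNReal.ofReal (c / scale d n)) :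
    volume (F '' cell d k m) ≤ ENNReal.ofReal (c / scale d k) := by
  obtain ⟨p, hp⟩ := scale_dvd d hkn
  have hk : (scale d k : ℝ) ≠ 0 := by exact_mod_cast (scale_pos d k).ne'
  have hp0 : (p : ℝ) ≠ 0 := by
    rintro h0
    have := scale_pos d n
    simp_all
  have hsub : F '' cell d k m ⊆
      ⋃ i ∈ Finset.range p, F '' (cell d n (m * p + i) ∩ cell d k m) := by
    rintro _ ⟨y, hy, rfl⟩
    have := cell_subset_iUnion d hp m hy
    simp only [Set.mem_iUnion] at this ⊢
    obtain ⟨i, hi, hyi⟩ := this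
    exact ⟨i, hi, y, ⟨hyi, hy⟩, rfl⟩
  calc volume (F '' cell d k m)
      ≤ ∑ i ∈ Finset.range p, volume (F '' (cell d n (m * p + i) ∩ cell d k m)) :=
        (measure_mono hsub).trans (measure_biUnion_finset_le _ _)
    _ ≤ ∑ _i ∈ Finset.range p, ENNReal.ofReal (c / scale d n) := by
        refine Finset.sum_le_sum fun i _ ↦ ?_
        rcases (cell d n (m * p + i) ∩ cell d k m).eq_empty_or_nonempty with h0 | h0
        · simp [h0]
        · exact h _ h0
    _ = ENNReal.ofReal (c / scale d k) := by
        rw [Finset.sum_const, Finset.card_range, nsmul_eq_mul, ← ENNReal.ofReal_natCast,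
          ← ENNReal.ofReal_mul (by positivity), hp]
        congr 1
        push_cast
        field_simp

lemma volume_image_sub_sawtoothSum_le {g : ℝ → ℝ} (hg : Differentiable ℝ g) {ε : ℝ} {n : ℕ}
    (hn : 1 / 2 ^ n ≤ ε) {m : ℤ}
    (hslope : ∀ y ∈ cell d n m, |deriv g y - ∑ k ∈ Finset.range (n + 1), d k| ≤ 2 * ε) :
    volume ((fun y ↦ g y - sawtoothSum d y) '' cell d n m) ≤
      ENNReal.ofReal (3 * ε / scale d n) := by
  have hε : 0 ≤ ε := le_trans (by positivity) hn
  refine (Real.volume_le_diam _).trans (Metric.ediam_le_of_forall_dist_le ?_)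
  rintro _ ⟨y, hy, rfl⟩ _ ⟨z, hz, rfl⟩
  set s := ∑ k ∈ Finset.range (n + 1), d k with hs
  have hder (x : ℝ) : HasDerivAt (fun x ↦ g x - s * x) (deriv g x - s) x :=
    ((hg x).hasDerivAt.sub ((hasDerivAt_id x).const_mul s)).congr_deriv (by simp)
  have hconv : Convex ℝ (cell d n m) := by
    rw [cell_eq_Ico]
    exact convex_Ico _ _
  have h1 := hconv.norm_image_sub_le_of_norm_hasDerivWithin_le
    (fun x _ ↦ (hder x).hasDerivWithinAt) hslope hz hy
  have h2 := abs_sawtoothSum_sub_le d hy hz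
  have h3 := abs_sub_le_of_mem_cell d hy hz
  rw [Real.norm_eq_abs, Real.norm_eq_abs] at h1
  rw [Real.dist_eq]
  calc |g y - sawtoothSum d y - (g z - sawtoothSum d z)|
      = |(g y - s * y - (g z - s * z)) -
          (sawtoothSum d y - sawtoothSum d z - s * (y - z))| := by congr 1; ring
    _ ≤ 2 * ε * |y - z| + 1 / scale d n / 2 ^ n := (abs_sub _ _).trans (add_le_add h1 h2)
    _ = 2 * ε * |y - z| + 1 / scale d n * (1 / 2 ^ n) := by ring
    _ ≤ 2 * ε * (1 / scale d n) + 1 / scale d n * ε := by gcongr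
    _ = 3 * ε / scale d n := by ring

/-- If the partial sums of `d` come close to every real infinitely often, the difference of a
`C¹` function and `sawtoothSum d` has null range. -/
theorem volume_range_sub_sawtoothSum
    (hd : ∀ (a ε : ℝ) (N : ℕ), 0 < ε →
      ∃ n ≥ N, |a - ∑ k ∈ Finset.range (n + 1), d k| ≤ ε)
    {g : ℝ → ℝ} (hg : ContDiff ℝ 1 g) :
    volume (Set.range fun y ↦ g y - sawtoothSum d y) = 0 := by
  have hdiff : Differentiable ℝ g := hg.differentiable one_ne_zero
  have hcell (m : ℤ) : volume ((fun y ↦ g y - sawtoothSum d y) '' cell d 0 m) = 0 := by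
    have key (ε : ℝ) (hε : 0 < ε) :
        volume ((fun y ↦ g y - sawtoothSum d y) '' cell d 0 m) ≤ ENNReal.ofReal (3 * ε) := by
      have huc := isCompact_Icc.uniformContinuousOn_of_continuous
        (hg.continuous_deriv le_rfl).continuousOn (s := Set.Icc (m : ℝ) (m + 1))
      obtain ⟨δ, hδ, huc⟩ := Metric.uniformContinuousOn_iff.1 huc ε hε
      obtain ⟨N, hN⟩ := exists_pow_lt_of_lt_one (lt_min hδ hε) (one_half_lt_one (α := ℝ))
      rw [div_pow, one_pow, lt_min_iff] at hN
      have hscale : 1 / (scale d N : ℝ) < δ := by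
        refine lt_of_le_of_lt ?_ hN.1
        gcongr
        exact_mod_cast two_pow_le_scale d N
      have hIcc : cell d 0 m ⊆ Set.Icc (m : ℝ) (m + 1) := by
        rw [cell_eq_Ico]
        simpa [scale] using Set.Ico_subset_Icc_self
      have hsub {k n : ℕ} (hkn : k ≤ n) {i j : ℤ} (h : (cell d n j ∩ cell d k i).Nonempty) :
          cell d n j ⊆ cell d k i := by
        obtain ⟨x, hx, hx'⟩ := h
        intro y hy
        exact (floor_eq_of_mem_cell d hkn hy hx).trans hx'
      have h0 := volume_image_cell_le d (F := fun y ↦ g y - sawtoothSum d y) (c := 3 * ε)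
        (Nat.zero_le N) (m := m) ?_
      · simpa [scale] using h0
      intro j hj
      have hj0 := hsub (Nat.zero_le N) hj
      rw [Set.inter_eq_left.2 hj0]
      obtain ⟨x, hx, -⟩ := hj
      obtain ⟨n, hn, hxn⟩ := hd (deriv g x) ε N hε
      refine volume_image_cell_le d hn fun i hi ↦ ?_
      have hij := hsub hn hi
      rw [Set.inter_eq_left.2 hij]
      refine volume_image_sub_sawtoothSum_le d hdiff ?_ fun y hy ↦ ?_
      · refine le_trans ?_ hN.2.le
        gcongr
        norm_num
      · have hyx := huc y (hIcc (hj0 (hij hy))) x (hIcc (hj0 hx))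
          ((abs_sub_le_of_mem_cell d (hij hy) hx).trans_lt hscale)
        rw [Real.dist_eq] at hyx
        linarith [abs_sub_le (deriv g y) (deriv g x) (∑ k ∈ Finset.range (n + 1), d k)]
    refine le_antisymm (ENNReal.le_of_forall_pos_le_add fun ε hε _ ↦ ?_) zero_le
    have := key (ε / 3) (by positivity)
    rwa [mul_div_cancel₀ _ three_ne_zero, ENNReal.ofReal_coe_nnreal, ← zero_add (ε : ENNReal)]
      at this
  refine measure_mono_null ?_ (measure_iUnion_null hcell)
  rintro _ ⟨y, rfl⟩
  exact Set.mem_iUnion.2 ⟨_, y, rfl, rfl⟩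

/-- A sequence coming arbitrarily close to every real infinitely often. -/
lemma exists_seq_frequently_near :
    ∃ s : ℕ → ℝ, ∀ (a ε : ℝ) (N : ℕ), 0 < ε → ∃ n ≥ N, |a - s n| ≤ ε := by
  refine ⟨fun n ↦ TopologicalSpace.denseSeq ℝ n.unpair.1, fun a ε N hε ↦ ?_⟩
  obtain ⟨k, hk⟩ := (TopologicalSpace.denseRange_denseSeq ℝ).exists_dist_lt a hε
  exact ⟨Nat.pair k N, Nat.right_le_pair k N, by simpa [Real.dist_eq] using hk.le⟩

end SawtoothSum

/-- There exists a function `ψ : ℝ → ℝ` such that for every `C¹` function `g : ℝ → ℝ`,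
the set `{ g y - ψ y : y ∈ ℝ }` has one-dimensional Lebesgue measure zero. -/
theorem universal_translation_one_dim :
    ∃ ψ : ℝ → ℝ, ∀ g : ℝ → ℝ, ContDiff ℝ 1 g →
      volume {x : ℝ | ∃ y : ℝ, x = g y - ψ y} = 0 := by
  obtain ⟨s, hs⟩ := SawtoothSum.exists_seq_frequently_near
  refine ⟨SawtoothSum.sawtoothSum (SawtoothSum.increment s), fun g hg ↦ ?_⟩
  simp only [eq_comm (b := g _ - _)]
  refine SawtoothSum.volume_range_sub_sawtoothSum _ (fun a ε N hε ↦ ?_) hg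
  simpa only [SawtoothSum.sum_increment] using hs a ε N hε
end

section
/- Let p, d, m be positive integers with p ≤ m. There exists a function ψ : ℝ^p → ℝ^m such that for every measurable g : ℝ^p × ℝ^d → ℝ^m with the property that for almost every t ∈ ℝ^d the map y ↦ g(y, t) is C¹, the set E := ⋃_{y ∈ ℝ^p} { (x, t) ∈ ℝ^m × ℝ^d : x = g(y, t) − ψ(y) } has (m + d)-dimensional Lebesgue measure zero. -/
open MeasureTheory

namespace UniversalTranslation

open Set Filter Topology

variable {p m : ℕ}

/-- The corner of index `k` of the cubic grid of mesh `1 / b`. -/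
noncomputable def gridPoint (b : ℕ) (k : Fin p → ℤ) : Fin p → ℝ := fun i => (k i : ℝ) / b

/-- The lower corner of the half-open cube of the grid of mesh `1 / b` that contains `y`. -/
noncomputable def gridFloor (b : ℕ) (y : Fin p → ℝ) : Fin p → ℝ :=
  gridPoint b fun i => ⌊(b : ℝ) * y i⌋

lemma gridPoint_injective {b : ℕ} (hb : 0 < b) :
    Function.Injective (gridPoint b : (Fin p → ℤ) → Fin p → ℝ) := by
  intro k l h
  ext i
  have hb' : (b : ℝ) ≠ 0 := by positivity
  have := congrFun h i
  simpa [gridPoint, div_left_inj' hb'] using this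

lemma gridFloor_gridFloor {b c : ℕ} (hbc : b ∣ c) (hc : 0 < c) (y : Fin p → ℝ) :
    gridFloor b (gridFloor c y) = gridFloor b y := by
  obtain ⟨q, rfl⟩ := hbc
  have hb : (b : ℝ) ≠ 0 := by
    have := Nat.pos_of_mul_pos_right hc
    positivity
  have hq : (q : ℝ) ≠ 0 := by
    have := Nat.pos_of_mul_pos_left hc
    positivity
  ext i
  have h₁ : (b : ℝ) * ((⌊((b * q : ℕ) : ℝ) * y i⌋ : ℝ) / ((b * q : ℕ) : ℝ))
      = (⌊((b * q : ℕ) : ℝ) * y i⌋ : ℝ) / (q : ℝ) := by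
    push_cast
    field_simp
  have h₂ : ((b * q : ℕ) : ℝ) * y i / (q : ℝ) = b * y i := by
    push_cast
    field_simp
  simp only [gridFloor, gridPoint]
  rw [h₁, Int.floor_div_natCast, Int.floor_intCast, ← Int.floor_div_natCast, h₂]

lemma norm_sub_gridFloor_le {b : ℕ} (hb : 0 < b) (y : Fin p → ℝ) :
    ‖y - gridFloor b y‖ ≤ 1 / b := by
  have hb' : (0 : ℝ) < b := by positivity
  refine (pi_norm_le_iff_of_nonneg (by positivity)).2 fun i => ?_
  have h₁ := Int.floor_le ((b : ℝ) * y i)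
  have h₂ := Int.lt_floor_add_one ((b : ℝ) * y i)
  have h₃ : (y - gridFloor b y) i = (b * y i - ⌊(b : ℝ) * y i⌋) / b := by
    simp only [gridFloor, gridPoint, Pi.sub_apply]
    field_simp
  rw [h₃, Real.norm_eq_abs, abs_of_nonneg (div_nonneg (by linarith) hb'.le)]
  gcongr
  linarith

lemma preimage_gridFloor {b : ℕ} (hb : 0 < b) (k : Fin p → ℤ) :
    gridFloor b ⁻¹' {gridPoint b k}
      = univ.pi fun i => Ico ((k i : ℝ) / b) ((k i : ℝ) / b + 1 / b) := by
  have hb' : (0 : ℝ) < b := by positivity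
  ext y
  simp only [gridFloor, mem_preimage, mem_singleton_iff, (gridPoint_injective hb).eq_iff,
    mem_univ_pi, mem_Ico, funext_iff, Int.floor_eq_iff, ← add_div, div_le_iff₀ hb',
    lt_div_iff₀ hb', mul_comm (b : ℝ)]

lemma measurableSet_preimage_gridFloor {b : ℕ} (hb : 0 < b) (k : Fin p → ℤ) :
    MeasurableSet (gridFloor b ⁻¹' {gridPoint b k}) := by
  rw [preimage_gridFloor hb]
  exact MeasurableSet.univ_pi fun i => measurableSet_Ico

lemma volume_preimage_gridFloor {b : ℕ} (hb : 0 < b) (k : Fin p → ℤ) :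
    volume (gridFloor b ⁻¹' {gridPoint b k}) = ENNReal.ofReal (1 / b) ^ p := by
  rw [preimage_gridFloor hb, Real.volume_pi_Ico]
  simp

/-- A sequence of grids, each refining the previous ones, starting from the unit grid. -/
structure IsRefining (b : ℕ → ℕ) : Prop where
  zero : b 0 = 1
  pos : ∀ j, 0 < b j
  dvd : ∀ i j, i ≤ j → b i ∣ b j
  two_pow_le : ∀ j, 2 ^ j ≤ b j

/-- The cubes selected by `A` that have no selected ancestor are disjoint, so those contained in
a given unit cube have total volume at most one. -/
lemma tsum_volume_maximal_le_one {b : ℕ → ℕ} (hb : IsRefining b) (A : ℕ → (Fin p → ℝ) → Prop)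
    (k₀ : Fin p → ℤ) (s : Set (ℕ × (Fin p → ℤ)))
    (hs : ∀ q ∈ s, A q.1 (gridPoint (b q.1) q.2) ∧
      (∀ i < q.1, ¬ A i (gridFloor (b i) (gridPoint (b q.1) q.2))) ∧
      gridFloor (b 0) (gridPoint (b q.1) q.2) = gridPoint (b 0) k₀) :
    ∑' q : s, ENNReal.ofReal (1 / b q.1.1) ^ p ≤ 1 := by
  have key : ∀ q ∈ s, ∀ r ∈ s, ∀ y, gridFloor (b q.1) y = gridPoint (b q.1) q.2 →
      gridFloor (b r.1) y = gridPoint (b r.1) r.2 → ¬ q.1 < r.1 := by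
    intro q hq r hr y hqy hry hlt
    refine (hs r hr).2.1 q.1 hlt ?_
    rw [← hry, gridFloor_gridFloor (hb.dvd _ _ hlt.le) (hb.pos _), hqy]
    exact (hs q hq).1
  calc ∑' q : s, ENNReal.ofReal (1 / b q.1.1) ^ p
      = ∑' q : s, volume (gridFloor (b q.1.1) ⁻¹' {gridPoint (b q.1.1) q.1.2}) := by
        simp only [volume_preimage_gridFloor (hb.pos _)]
    _ = volume (⋃ q : s, gridFloor (b q.1.1) ⁻¹' {gridPoint (b q.1.1) q.1.2}) := by
        refine (measure_iUnion ?_ fun q =>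
          measurableSet_preimage_gridFloor (hb.pos _) _).symm
        rintro ⟨⟨j, k⟩, hq⟩ ⟨⟨j', k'⟩, hr⟩ hne
        refine Set.disjoint_left.2 fun y hy hy' => hne ?_
        simp only [mem_preimage, mem_singleton_iff] at hy hy'
        obtain rfl : j = j' :=
          le_antisymm (not_lt.1 (key _ hr _ hq y hy' hy)) (not_lt.1 (key _ hq _ hr y hy hy'))
        obtain rfl : k = k' := gridPoint_injective (hb.pos j) (hy.symm.trans hy')
        rfl
    _ ≤ volume (gridFloor (b 0) ⁻¹' {gridPoint (b 0) k₀}) := by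
        refine measure_mono (iUnion_subset fun q y hy => ?_)
        simp only [mem_preimage, mem_singleton_iff] at hy ⊢
        rw [← (hs q q.2).2.2, ← hy, gridFloor_gridFloor (hb.dvd _ _ (Nat.zero_le _)) (hb.pos _)]
    _ = 1 := by rw [volume_preimage_gridFloor (hb.pos _), hb.zero]; simp

lemma exists_isRefining (w : ℕ → ℝ) :
    ∃ b : ℕ → ℕ, IsRefining b ∧ ∀ j, w j * b j ≤ b (j + 1) := by
  refine ⟨fun j => ∏ i ∈ Finset.range j, (⌈w i⌉₊ + 2), ⟨by simp, fun j => ?_, fun i j hij => ?_,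
    fun j => ?_⟩, fun j => ?_⟩
  · exact Finset.prod_pos fun i _ => by omega
  · exact Finset.prod_dvd_prod_of_subset _ _ _ (by simpa using hij)
  · simpa using Finset.pow_card_le_prod (Finset.range j) (fun i => ⌈w i⌉₊ + 2) 2
      (fun i _ => by omega)
  · simp only [Finset.prod_range_succ, mul_comm (w j)]
    push_cast
    gcongr
    linarith [Nat.le_ceil (w j)]

/-- The value at the lower corner of the `j`-th cube containing `y` of the function with slope
`a i` at the scale of the `i`-th grid. -/
noncomputable def gridSum (a : ℕ → (Fin p → ℝ) →L[ℝ] (Fin m → ℝ)) (b : ℕ → ℕ) (j : ℕ)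
    (y : Fin p → ℝ) : Fin m → ℝ :=
  ∑ i ∈ Finset.range j, a i (gridFloor (b (i + 1)) y - gridFloor (b i) y)

lemma gridSum_gridFloor (a : ℕ → (Fin p → ℝ) →L[ℝ] (Fin m → ℝ)) {b : ℕ → ℕ}
    (hb : IsRefining b) (j : ℕ) (y : Fin p → ℝ) :
    gridSum a b j (gridFloor (b j) y) = gridSum a b j y := by
  refine Finset.sum_congr rfl fun i hi => ?_
  have hi := Finset.mem_range.1 hi
  rw [gridFloor_gridFloor (hb.dvd _ _ hi) (hb.pos _),
    gridFloor_gridFloor (hb.dvd _ _ hi.le) (hb.pos _)]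

/-- There is a function having slope approximately `a j` on each cube of the `j`-th grid. -/
lemma exists_slopes (a : ℕ → (Fin p → ℝ) →L[ℝ] (Fin m → ℝ)) {b : ℕ → ℕ}
    (hb : IsRefining b) (hab : ∀ j, ‖a (j + 1) - a j‖ * 2 ^ j * b j ≤ b (j + 1)) :
    ∃ ψ : (Fin p → ℝ) → (Fin m → ℝ), ∀ j y,
      ‖gridSum a b j y + a j (y - gridFloor (b j) y) - ψ y‖ ≤ 2 / 2 ^ j / b j := by
  set u : ℕ → (Fin p → ℝ) → (Fin m → ℝ) :=
    fun j y => gridSum a b j y + a j (y - gridFloor (b j) y) with hu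
  have hpos : ∀ j, (0 : ℝ) < b j := fun j => by exact_mod_cast hb.pos j
  have hmono : ∀ i j, i ≤ j → (b i : ℝ) ≤ b j := fun i j hij => by
    exact_mod_cast Nat.le_of_dvd (hb.pos j) (hb.dvd i j hij)
  have hstep : ∀ j y, dist (u j y) (u (j + 1) y) ≤ 1 / 2 ^ j / b j := by
    intro j y
    have h₁ : u (j + 1) y - u j y = (a (j + 1) - a j) (y - gridFloor (b (j + 1)) y) := by
      simp only [hu, gridSum, Finset.sum_range_succ, map_sub, sub_apply]
      abel
    rw [dist_comm, dist_eq_norm, h₁]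
    refine ((a (j + 1) - a j).le_opNorm _).trans ?_
    calc ‖a (j + 1) - a j‖ * ‖y - gridFloor (b (j + 1)) y‖
        ≤ ‖a (j + 1) - a j‖ * (1 / b (j + 1)) := by
          gcongr
          exact norm_sub_gridFloor_le (hb.pos _) y
      _ ≤ 1 / 2 ^ j / b j := by
          rw [div_div, mul_one_div, div_le_div_iff₀ (hpos _) (by have := hpos j; positivity),
            one_mul, ← mul_assoc]
          exact hab j
  have htail : ∀ j y n, dist (u (j + n) y) (u (j + (n + 1)) y)
      ≤ 2 / 2 ^ j / b j / 2 / 2 ^ n := by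
    intro j y n
    calc dist (u (j + n) y) (u (j + (n + 1)) y) ≤ 1 / 2 ^ (j + n) / b (j + n) := hstep (j + n) y
      _ ≤ 1 / 2 ^ (j + n) / b j := by
          have := hpos j
          exact div_le_div_of_nonneg_left (by positivity) this (hmono _ _ (Nat.le_add_right _ _))
      _ = 2 / 2 ^ j / b j / 2 / 2 ^ n := by
          rw [pow_add]
          field_simp
  have hlim : ∀ y, ∃ v, Tendsto (fun n => u n y) atTop (𝓝 v) := fun y =>
    cauchySeq_tendsto_of_complete
      (cauchySeq_of_le_geometric_two (C := 2 / 2 ^ 0 / b 0) fun n => by simpa using htail 0 y n)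
  choose ψ hψ using hlim
  refine ⟨ψ, fun j y => ?_⟩
  rw [← dist_eq_norm]
  exact dist_le_of_le_geometric_two_of_tendsto₀ (f := fun n => u (j + n) y) (htail j y)
    ((hψ y).comp (tendsto_add_atTop_nat j |>.congr fun n => add_comm _ _))

/-- If every tail of `a` is dense, then at every point a `C¹` function has slope approximately
`a j` on the `j`-th cube, for some large `j`. -/
lemma exists_slope_approx {a : ℕ → (Fin p → ℝ) →L[ℝ] (Fin m → ℝ)} {b : ℕ → ℕ}
    (hb : IsRefining b) (ha : ∀ L, ∀ ε > 0, ∀ N, ∃ j ≥ N, ‖L - a j‖ < ε)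
    {f : (Fin p → ℝ) → (Fin m → ℝ)} (hf : ContDiff ℝ 1 f) {ε : ℝ} (hε : 0 < ε) (N : ℕ)
    (y : Fin p → ℝ) :
    ∃ j ≥ N, ∀ z, dist z (gridFloor (b j) y) < 2 / b j →
      ‖f z - f (gridFloor (b j) y) - a j (z - gridFloor (b j) y)‖ ≤ ε / b j := by
  have hpos : ∀ j, (0 : ℝ) < b j := fun j => by exact_mod_cast hb.pos j
  have hstrict := hf.contDiffAt.hasStrictFDerivAt (x := y) one_ne_zero
  set L := fderiv ℝ f y
  obtain ⟨s, hs, hfs⟩ := hstrict.approximates_deriv_on_nhds (c := ⟨ε / 4, by positivity⟩)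
    (Or.inr (show (0 : ℝ) < ε / 4 by positivity))
  obtain ⟨ρ, hρ, hρs⟩ := Metric.mem_nhds_iff.1 hs
  obtain ⟨K, hK⟩ := exists_pow_lt_of_lt_one (show 0 < ρ / 3 by positivity) one_half_lt_one
  obtain ⟨j, hj, hLj⟩ := ha L (ε / 4) (by positivity) (max N K)
  refine ⟨j, le_trans (le_max_left _ _) hj, fun z hz => ?_⟩
  set c := gridFloor (b j) y
  have hbj : 1 / (b j : ℝ) < ρ / 3 := by
    refine lt_of_le_of_lt ?_ hK
    rw [one_div_pow]
    gcongr
    have h₁ := hb.two_pow_le j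
    have h₂ : 2 ^ K ≤ 2 ^ j := Nat.pow_le_pow_right two_pos (le_trans (le_max_right _ _) hj)
    exact_mod_cast h₂.trans h₁
  have hcy : dist c y ≤ 1 / b j := by
    rw [dist_comm, dist_eq_norm]
    exact norm_sub_gridFloor_le (hb.pos j) y
  have h2 : 2 / (b j : ℝ) = 2 * (1 / b j) := by ring
  have hcs : c ∈ s := hρs (by rw [Metric.mem_ball]; linarith)
  have hzs : z ∈ s := hρs (by
    rw [Metric.mem_ball]
    linarith [dist_triangle z c y])
  have hzc : ‖z - c‖ ≤ 2 / b j := by rw [← dist_eq_norm]; exact hz.le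
  have h₁ : ‖f z - f c - L (z - c)‖ ≤ ε / 4 * ‖z - c‖ := hfs z hzs c hcs
  have h₂ : ‖(L - a j) (z - c)‖ ≤ ε / 4 * ‖z - c‖ :=
    ((L - a j).le_opNorm _).trans (by gcongr)
  calc ‖f z - f c - a j (z - c)‖ = ‖(f z - f c - L (z - c)) + (L - a j) (z - c)‖ := by
        rw [sub_apply, sub_add_sub_cancel]
    _ ≤ ε / 4 * ‖z - c‖ + ε / 4 * ‖z - c‖ := norm_add_le_of_le h₁ h₂
    _ = ε / 2 * ‖z - c‖ := by ring
    _ ≤ ε / 2 * (2 / b j) := by gcongr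
    _ = ε / b j := by ring

lemma exists_dense_tails (p m : ℕ) : ∃ a : ℕ → (Fin p → ℝ) →L[ℝ] (Fin m → ℝ),
    ∀ L, ∀ ε > 0, ∀ N, ∃ j ≥ N, ‖L - a j‖ < ε := by
  refine ⟨fun j => TopologicalSpace.denseSeq _ (Nat.unpair j).1, fun L ε hε N => ?_⟩
  obtain ⟨n, hn⟩ := Metric.denseRange_iff.1
    (TopologicalSpace.denseRange_denseSeq ((Fin p → ℝ) →L[ℝ] (Fin m → ℝ))) L ε hε
  refine ⟨Nat.pair n N, Nat.right_le_pair n N, ?_⟩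
  simpa only [Nat.unpair_pair, ← dist_eq_norm] using hn

section Cover

variable {T : Type*} (a : ℕ → (Fin p → ℝ) →L[ℝ] (Fin m → ℝ)) (b : ℕ → ℕ)
  (D : ℕ → Fin p → ℝ) (g : (Fin p → ℝ) → T → (Fin m → ℝ)) (ε : ℝ) (N : ℕ)

/-- The parameters `t` for which `y ↦ g y t` has slope approximately `a j` near the cube of the
`j`-th grid with corner `c`, tested on the sequence `D`. -/
def slopeSet (j : ℕ) (c : Fin p → ℝ) : Set T :=
  {t | N ≤ j ∧ ∀ n, dist (D n) c < 2 / b j →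
    ‖g (D n) t - g c t - a j (D n - c)‖ ≤ ε / b j}

/-- The parameters `t` for which the cube of the `j`-th grid with corner `c` is a maximal
cube such that `t ∈ slopeSet`, and is contained in the unit cube of index `k₀`. -/
def maximalSet (k₀ : Fin p → ℤ) (q : ℕ × (Fin p → ℤ)) : Set T :=
  {t | t ∈ slopeSet a b D g ε N q.1 (gridPoint (b q.1) q.2) ∧
    (∀ i < q.1, t ∉ slopeSet a b D g ε N i (gridFloor (b i) (gridPoint (b q.1) q.2))) ∧
    gridFloor (b 0) (gridPoint (b q.1) q.2) = gridPoint (b 0) k₀}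

/-- A measurable cover of the union of the translated surfaces. -/
def cover (k₀ : Fin p → ℤ) : Set ((Fin m → ℝ) × T) :=
  ⋃ q : ℕ × (Fin p → ℤ), {xt | xt.2 ∈ maximalSet a b D g ε N k₀ q ∧
    ‖xt.1 - (g (gridPoint (b q.1) q.2) xt.2 - gridSum a b q.1 (gridPoint (b q.1) q.2))‖
      ≤ 2 * ε / b q.1}

variable {a b D g ε N}

lemma measurableSet_cover [MeasurableSpace T] (hg : ∀ y, Measurable (g y)) (k₀ : Fin p → ℤ) :
    MeasurableSet (cover a b D g ε N k₀) := by
  have hslope : ∀ j c, MeasurableSet (slopeSet a b D g ε N j c) := by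
    intro j c
    have h : slopeSet a b D g ε N j c = {_t | N ≤ j} ∩ ⋂ n, ⋂ _ : dist (D n) c < 2 / b j,
        {t | ‖g (D n) t - g c t - a j (D n - c)‖ ≤ ε / b j} := by
      ext t
      simp [slopeSet]
    rw [h]
    refine (MeasurableSet.const _).inter ?_
    refine MeasurableSet.iInter fun n => MeasurableSet.iInter fun _ => ?_
    exact measurableSet_le ((((hg _).sub (hg _)).sub_const _).norm) measurable_const
  have hmax : ∀ q, MeasurableSet (maximalSet a b D g ε N k₀ q) := by
    intro q
    have h : maximalSet a b D g ε N k₀ q = slopeSet a b D g ε N q.1 (gridPoint (b q.1) q.2) ∩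
        ((⋂ i, ⋂ _ : i < q.1,
          (slopeSet a b D g ε N i (gridFloor (b i) (gridPoint (b q.1) q.2)))ᶜ) ∩
        {_t | gridFloor (b 0) (gridPoint (b q.1) q.2) = gridPoint (b 0) k₀}) := by
      ext t
      simp only [maximalSet, mem_ofPred_eq, mem_inter_iff, mem_iInter, mem_compl_iff]
    rw [h]
    exact (hslope _ _).inter ((MeasurableSet.iInter fun i => MeasurableSet.iInter fun _ =>
      (hslope _ _).compl).inter (MeasurableSet.const _))
  refine MeasurableSet.iUnion fun q => (measurable_snd (hmax q)).inter ?_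
  exact measurableSet_le ((measurable_fst.sub
    (((hg _).comp measurable_snd).sub_const _)).norm) measurable_const

lemma volume_section_cover_le (hb : IsRefining b) (hpm : p ≤ m) (hε : 0 ≤ ε) (k₀ : Fin p → ℤ)
    (t : T) :
    volume ((fun x => (x, t)) ⁻¹' cover a b D g ε N k₀) ≤ ENNReal.ofReal (4 * ε) ^ m := by
  have hpos : ∀ j, (0 : ℝ) < b j := fun j => by exact_mod_cast hb.pos j
  set s : Set (ℕ × (Fin p → ℤ)) := {q | t ∈ maximalSet a b D g ε N k₀ q} with hs
  calc volume ((fun x => (x, t)) ⁻¹' cover a b D g ε N k₀)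
      ≤ volume (⋃ q : s, Metric.closedBall (g (gridPoint (b q.1.1) q.1.2) t
          - gridSum a b q.1.1 (gridPoint (b q.1.1) q.1.2)) (2 * ε / b q.1.1)) := by
        refine measure_mono fun x hx => ?_
        obtain ⟨q, hq, hxq⟩ := mem_iUnion.1 hx
        exact mem_iUnion.2 ⟨⟨q, hq⟩, by rwa [Metric.mem_closedBall, dist_eq_norm]⟩
    _ ≤ ∑' q : s, volume (Metric.closedBall (g (gridPoint (b q.1.1) q.1.2) t
          - gridSum a b q.1.1 (gridPoint (b q.1.1) q.1.2)) (2 * ε / b q.1.1)) :=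
        measure_iUnion_le _
    _ ≤ ∑' q : s, ENNReal.ofReal (4 * ε) ^ m * ENNReal.ofReal (1 / b q.1.1) ^ p := by
        refine ENNReal.tsum_le_tsum fun q => ?_
        have hq := hpos q.1.1
        rw [Real.volume_pi_closedBall _ (by positivity), Fintype.card_fin,
          show 2 * (2 * ε / b q.1.1) = 4 * ε * (1 / b q.1.1) by ring,
          ENNReal.ofReal_pow (by positivity), ENNReal.ofReal_mul (by positivity), mul_pow]
        refine mul_le_mul_right ?_ _
        refine pow_le_pow_of_le_one zero_le ?_ hpm
        rw [ENNReal.ofReal_le_one, div_le_one hq]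
        exact_mod_cast hb.pos _
    _ = ENNReal.ofReal (4 * ε) ^ m * ∑' q : s, ENNReal.ofReal (1 / b q.1.1) ^ p :=
        ENNReal.tsum_mul_left
    _ ≤ ENNReal.ofReal (4 * ε) ^ m := by
        refine mul_le_of_le_one_right zero_le ?_
        exact tsum_volume_maximal_le_one hb (fun j c => t ∈ slopeSet a b D g ε N j c) k₀ s
          fun q hq => hq

lemma mem_cover (hb : IsRefining b) (ha : ∀ L, ∀ ε > 0, ∀ N, ∃ j ≥ N, ‖L - a j‖ < ε)
    (hD : DenseRange D) {ψ : (Fin p → ℝ) → (Fin m → ℝ)}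
    (hψ : ∀ j y, ‖gridSum a b j y + a j (y - gridFloor (b j) y) - ψ y‖ ≤ 2 / 2 ^ j / b j)
    (hε : 0 < ε) (hN : 2 / 2 ^ N ≤ ε) {t : T} (ht : ContDiff ℝ 1 fun y => g y t)
    (y : Fin p → ℝ) :
    (g y t - ψ y, t) ∈ cover a b D g ε N fun i => ⌊(b 0 : ℝ) * y i⌋ := by
  classical
  have hex : ∃ j, t ∈ slopeSet a b D g ε N j (gridFloor (b j) y) := by
    obtain ⟨j, hj, h⟩ := exists_slope_approx hb ha ht hε N y
    exact ⟨j, hj, fun n hn => h _ hn⟩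
  set j := Nat.find hex
  have hpos : (0 : ℝ) < b j := by exact_mod_cast hb.pos j
  have hj : t ∈ slopeSet a b D g ε N j (gridFloor (b j) y) := Nat.find_spec hex
  refine mem_iUnion.2 ⟨(j, fun i => ⌊(b j : ℝ) * y i⌋), ⟨hj, fun i hi => ?_, ?_⟩, ?_⟩
  · change t ∉ slopeSet a b D g ε N i (gridFloor (b i) (gridFloor (b j) y))
    rw [gridFloor_gridFloor (hb.dvd _ _ (le_of_lt hi)) (hb.pos _)]
    exact Nat.find_min hex hi
  · exact gridFloor_gridFloor (hb.dvd _ _ (Nat.zero_le _)) (hb.pos _) y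
  · change ‖g y t - ψ y - (g (gridFloor (b j) y) t - gridSum a b j (gridFloor (b j) y))‖ ≤ _
    rw [gridSum_gridFloor a hb]
    set c := gridFloor (b j) y
    have hy : y ∈ closure (Metric.ball c (2 / b j) ∩ range D) := by
      refine hD.open_subset_closure_inter Metric.isOpen_ball ?_
      rw [Metric.mem_ball, dist_eq_norm]
      refine (norm_sub_gridFloor_le (hb.pos j) y).trans_lt ?_
      gcongr
      norm_num
    have h₁ : ‖g y t - g c t - a j (y - c)‖ ≤ ε / b j := by
      have hclosed : IsClosed {z | ‖g z t - g c t - a j (z - c)‖ ≤ ε / b j} := by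
        have := ht.continuous
        exact isClosed_le (by fun_prop) continuous_const
      refine closure_minimal ?_ hclosed hy
      rintro _ ⟨hz, n, rfl⟩
      exact hj.2 n hz
    have h₂ : ‖gridSum a b j y + a j (y - c) - ψ y‖ ≤ ε / b j := by
      refine (hψ j y).trans ?_
      gcongr
      refine le_trans ?_ hN
      gcongr
      · norm_num
      · exact hj.1
    calc ‖g y t - ψ y - (g c t - gridSum a b j y)‖
        = ‖(g y t - g c t - a j (y - c)) + (gridSum a b j y + a j (y - c) - ψ y)‖ := by
          congr 1
          abel
      _ ≤ ε / b j + ε / b j := norm_add_le_of_le h₁ h₂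
      _ = 2 * ε / b j := by ring

end Cover

end UniversalTranslation

open UniversalTranslation Set Filter Topology

/-- Translation case of the main theorem in arbitrary codimension: for `p ≤ m` there is a
universal `ψ : ℝ^p → ℝ^m` such that for every measurable `g : ℝ^p × ℝ^d → ℝ^m` with
`y ↦ g y t` of class `C¹` for a.e. `t`, the union over `y` of the translated surfaces
`{(x, t) : x = g y t - ψ y}` is a Lebesgue null subset of `ℝ^m × ℝ^d`. -/
theorem universal_translation_codim (p d m : ℕ) (hp : 0 < p) (hd : 0 < d) (hm : 0 < m)
    (hpm : p ≤ m) :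
    ∃ ψ : (Fin p → ℝ) → (Fin m → ℝ),
      ∀ g : (Fin p → ℝ) → (Fin d → ℝ) → (Fin m → ℝ),
        Measurable (fun x : (Fin p → ℝ) × (Fin d → ℝ) => g x.1 x.2) →
        (∀ᵐ t : Fin d → ℝ, ContDiff ℝ 1 (fun y : Fin p → ℝ => g y t)) →
        volume {xt : (Fin m → ℝ) × (Fin d → ℝ) |
          ∃ y : Fin p → ℝ, xt.1 = g y xt.2 - ψ y} = 0 := by
  obtain ⟨a, ha⟩ := exists_dense_tails p m
  obtain ⟨b, hb, hab⟩ := exists_isRefining fun j => ‖a (j + 1) - a j‖ * 2 ^ j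
  obtain ⟨ψ, hψ⟩ := exists_slopes a hb hab
  refine ⟨ψ, fun g hg hC => ?_⟩
  have hgy : ∀ y, Measurable (g y) := fun y => hg.comp measurable_prodMk_left
  set D := TopologicalSpace.denseSeq (Fin p → ℝ)
  have hD : DenseRange D := TopologicalSpace.denseRange_denseSeq _
  set M : (Fin p → ℤ) → Set ((Fin m → ℝ) × (Fin d → ℝ)) :=
    fun k => ⋂ n : ℕ, cover a b D g (2 / 2 ^ n) n k
  have hM : ∀ k, volume (M k) = 0 := by
    intro k
    have hmeas : MeasurableSet (M k) := MeasurableSet.iInter fun n => measurableSet_cover hgy k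
    rw [Measure.volume_eq_prod, Measure.prod_apply_symm hmeas, lintegral_eq_zero_of_ae_eq_zero]
    refine Eventually.of_forall fun t => ?_
    have hlim : Tendsto (fun n : ℕ => ENNReal.ofReal (4 * (2 / 2 ^ n)) ^ m) atTop (𝓝 0) := by
      have h₁ : Tendsto (fun n : ℕ => (4 : ℝ) * (2 / 2 ^ n)) atTop (𝓝 0) := by
        have := (tendsto_pow_atTop_nhds_zero_of_lt_one (r := (1 / 2 : ℝ)) (by norm_num)
          (by norm_num)).const_mul 8
        rw [mul_zero] at this
        refine this.congr fun n => ?_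
        rw [one_div_pow]
        ring
      have h₂ := ENNReal.Tendsto.pow (n := m) (ENNReal.tendsto_ofReal h₁)
      rwa [ENNReal.ofReal_zero, zero_pow hm.ne'] at h₂
    refine le_antisymm (ge_of_tendsto' hlim fun n => ?_) zero_le
    exact (measure_mono (preimage_mono (iInter_subset _ n))).trans
      (volume_section_cover_le hb hpm (by positivity) k t)
  have hbad : ∀ᵐ xt : (Fin m → ℝ) × (Fin d → ℝ), ContDiff ℝ 1 fun y => g y xt.2 :=
    Measure.quasiMeasurePreserving_snd.ae hC
  refine measure_mono_null (t := (⋃ k, M k) ∪ {xt | ¬ ContDiff ℝ 1 fun y => g y xt.2}) ?_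
    (measure_union_null (measure_iUnion_null hM) hbad)
  rintro ⟨x, t⟩ ⟨y, hx⟩
  obtain rfl : x = g y t - ψ y := hx
  by_cases ht : ContDiff ℝ 1 fun y => g y t
  · exact Or.inl (mem_iUnion.2 ⟨_, mem_iInter.2 fun n =>
      mem_cover hb ha hD hψ (by positivity) le_rfl ht y⟩)
  · exact Or.inr ht
end
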